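/- (Claims 2 and 3) Let A₁'={x^{−σ_p}, x^{−σ_q,1_{[q̄]}} : p∈I_{2,3}, q∈I₅}, A₁=A₁' if 𝒥₀={0} and A₁=A₁'∪{1} if 𝒥₀=ℕ; let A₂'={x^{−σ_p}, x^{−σ_q,1_{[q̄]}}, t^{1_{[r]}+1_{[r̄]}} : p∈I₁, q∈I₄, r∈I₆}, A₂=A₂'∪{1} if 𝒥₀={0} and A₂=A₂' if 𝒥₀=ℕ. For every derivation d of 𝒦 there exists u∈𝒦 such that (d − ad u)(y)=0 for all y∈A₁∪A₂. -/

import Mathlib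

noncomputable section

/-- `ι_i = ℓ₁ + ⋯ + ℓ_i`. -/
def iot (ℓ : ℕ → ℕ) (i : ℕ) : ℕ := ∑ k ∈ Finset.Icc 1 i, ℓ k

/-- `I_{i,j} = {ι_{i-1}+1, …, ι_j}`. -/
def iSet (ℓ : ℕ → ℕ) (i j : ℕ) : Finset ℕ := Finset.Icc (iot ℓ (i - 1) + 1) (iot ℓ j)

/-- The index-shift map `p ↦ p̄` (shift by `ι₆`). -/
def bar (ℓ : ℕ → ℕ) (p : ℕ) : ℕ := if p ≤ iot ℓ 6 then p + iot ℓ 6 else p - iot ℓ 6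

/-- `K̄ = {p̄ : p ∈ K}`. -/
def barSet (ℓ : ℕ → ℕ) (K : Finset ℕ) : Finset ℕ := K.image (bar ℓ)

/-- `J_{i,j} = I_{i,j} ∪ Ī_{i,j}`. -/
def jSet (ℓ : ℕ → ℕ) (i j : ℕ) : Finset ℕ := iSet ℓ i j ∪ barSet ℓ (iSet ℓ i j)

/-- The semigroup `𝒥 = 𝒥₀ × 𝒥₁`, encoded as functions `ℕ → ℕ`; `j0 = true`
means `𝒥₀ = ℕ` and `j0 = false` means `𝒥₀ = {0}`. -/
def jIdx (ℓ : ℕ → ℕ) (j0 : Bool) : Set (ℕ → ℕ) :=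
  {i | (j0 = false → i 0 = 0) ∧
    ∀ p, 1 ≤ p →
      (p ∈ iSet ℓ 1 2 ∪ iSet ℓ 4 4 ∪ barSet ℓ (iSet ℓ 1 1) ∨ 2 * iot ℓ 6 < p) → i p = 0}

/-- `σ_p` (with `σ_p = σ_{p̄}`). -/
def sgm (F : Type*) [Field F] (ℓ : ℕ → ℕ) (p : ℕ) : ℕ → F :=
  let q := if p ≤ iot ℓ 6 then p else p - iot ℓ 6
  if q ∈ iSet ℓ 1 3 then -Pi.single q (1 : F) - Pi.single (q + iot ℓ 6) (1 : F)
  else if q ∈ iSet ℓ 4 5 then -Pi.single q (1 : F)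
  else 0

/-- The underlying space `𝒜`: the free `F`-module with basis `Γ × 𝒥`. -/
abbrev CA (F : Type*) [Field F] (ℓ : ℕ → ℕ) (Γ : AddSubgroup (ℕ → F)) (j0 : Bool) : Type _ :=
  (↥Γ × ↥(jIdx ℓ j0)) →₀ F

/-- The basis monomial `x^{α,i⃗}`, with the convention that it is `0` if `(α,i⃗) ∉ Γ × 𝒥`. -/
def X (F : Type*) [Field F] (ℓ : ℕ → ℕ) (Γ : AddSubgroup (ℕ → F)) (j0 : Bool)
    (α : ℕ → F) (i : ℕ → ℕ) : CA F ℓ Γ j0 :=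
  @dite _ (α ∈ Γ ∧ i ∈ jIdx ℓ j0) (Classical.dec _)
    (fun h => Finsupp.single (⟨α, h.1⟩, ⟨i, h.2⟩) 1) (fun _ => 0)

variable (F : Type*) [Field F] (ℓ : ℕ → ℕ) (Γ : AddSubgroup (ℕ → F)) (j0 : Bool)

/-- The commutative associative product on `𝒜`. -/
def mulA (u v : CA F ℓ Γ j0) : CA F ℓ Γ j0 :=
  u.sum fun a ca => v.sum fun b cb =>
    (ca * cb) • X F ℓ Γ j0 (a.1.1 + b.1.1) (a.2.1 + b.2.1)

/-- The grading operator `∂*_p`. -/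
def pstar (p : ℕ) (u : CA F ℓ Γ j0) : CA F ℓ Γ j0 :=
  u.sum fun a ca => (ca * a.1.1 p) • Finsupp.single a 1

/-- The down-grading operator `∂_{t_p}`. -/
def pt (p : ℕ) (u : CA F ℓ Γ j0) : CA F ℓ Γ j0 :=
  u.sum fun a ca => (ca * (a.2.1 p : F)) • X F ℓ Γ j0 a.1.1 (a.2.1 - Pi.single p 1)

/-- `∂_p = ∂*_p + ∂_{t_p}`. -/
def dd (p : ℕ) (u : CA F ℓ Γ j0) : CA F ℓ Γ j0 := pstar F ℓ Γ j0 p u + pt F ℓ Γ j0 p u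

/-- `∂ = Σ_{p∈J_{1,3}∪I_{4,5}} ∂*_p + Σ_{p∈I₆∪Ī_{4,6}} t_p ∂_{t_p}`. -/
def Dop (u : CA F ℓ Γ j0) : CA F ℓ Γ j0 :=
  (∑ p ∈ jSet ℓ 1 3 ∪ iSet ℓ 4 5, pstar F ℓ Γ j0 p u) +
    ∑ p ∈ iSet ℓ 6 6 ∪ barSet ℓ (iSet ℓ 4 6),
      mulA F ℓ Γ j0 (X F ℓ Γ j0 0 (Pi.single p 1)) (pt F ℓ Γ j0 p u)

/-- The contact bracket (2.18):
`[u,v] = Σ_{p∈I} x^{σ_p}(∂_p u·∂_{p̄} v − ∂_{p̄} u·∂_p v) + (2−∂)(u)·∂₀(v) − ∂₀(u)·(2−∂)(v)`. -/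
def brk (u v : CA F ℓ Γ j0) : CA F ℓ Γ j0 :=
  (∑ p ∈ iSet ℓ 1 6,
      mulA F ℓ Γ j0 (X F ℓ Γ j0 (sgm F ℓ p) 0)
        (mulA F ℓ Γ j0 (dd F ℓ Γ j0 p u) (dd F ℓ Γ j0 (bar ℓ p) v) -
          mulA F ℓ Γ j0 (dd F ℓ Γ j0 (bar ℓ p) u) (dd F ℓ Γ j0 p v))) +
    mulA F ℓ Γ j0 ((2 : F) • u - Dop F ℓ Γ j0 u) (dd F ℓ Γ j0 0 v) -
    mulA F ℓ Γ j0 (dd F ℓ Γ j0 0 u) ((2 : F) • v - Dop F ℓ Γ j0 v)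


/-- The set `A₁`: the ad-locally-finite but not ad-semisimple basis elements
(`x^{−σ_p}` for `p ∈ I_{2,3}`, `x^{−σ_q,1_{[q̄]}}` for `q ∈ I₅`, plus `1` if `𝒥₀ = ℕ`). -/
def A1 (F : Type*) [Field F] (ℓ : ℕ → ℕ) (Γ : AddSubgroup (ℕ → F)) (j0 : Bool) :
    Set (CA F ℓ Γ j0) :=
  ((fun p => X F ℓ Γ j0 (-sgm F ℓ p) 0) '' ↑(iSet ℓ 2 3)) ∪
    ((fun q => X F ℓ Γ j0 (-sgm F ℓ q) (Pi.single (bar ℓ q) 1)) '' ↑(iSet ℓ 5 5)) ∪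
    {y | j0 = true ∧ y = X F ℓ Γ j0 0 0}

/-- The set `A₂`: the ad-semisimple elements
(`x^{−σ_p}` for `p ∈ I₁`, `x^{−σ_q,1_{[q̄]}}` for `q ∈ I₄`, `t^{1_{[r]}+1_{[r̄]}}` for
`r ∈ I₆`, plus `1` if `𝒥₀ = {0}`). -/
def A2 (F : Type*) [Field F] (ℓ : ℕ → ℕ) (Γ : AddSubgroup (ℕ → F)) (j0 : Bool) :
    Set (CA F ℓ Γ j0) :=
  ((fun p => X F ℓ Γ j0 (-sgm F ℓ p) 0) '' ↑(iSet ℓ 1 1)) ∪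
    ((fun q => X F ℓ Γ j0 (-sgm F ℓ q) (Pi.single (bar ℓ q) 1)) '' ↑(iSet ℓ 4 4)) ∪
    ((fun r => X F ℓ Γ j0 0 (Pi.single r 1 + Pi.single (bar ℓ r) 1)) '' ↑(iSet ℓ 6 6)) ∪
    {y | j0 = false ∧ y = X F ℓ Γ j0 0 0}

/-- The set `A₃`: `x^{2_{[p]}}` for `p ∈ I_{1,5}`, `t^{2_{[q]}}` for `q ∈ I₆`, plus
`x^{2_{[0]}}` if `Γ₀ ≠ {0}` or `t₀` if `Γ₀ = {0}`. -/
def A3 (F : Type*) [Field F] (ℓ : ℕ → ℕ) (Γ : AddSubgroup (ℕ → F)) (j0 : Bool) :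
    Set (CA F ℓ Γ j0) :=
  ((fun p => X F ℓ Γ j0 (Pi.single p (2 : F)) 0) '' ↑(iSet ℓ 1 5)) ∪
    ((fun q => X F ℓ Γ j0 0 (Pi.single q 2)) '' ↑(iSet ℓ 6 6)) ∪
    {y | ((∃ α ∈ Γ, α 0 ≠ 0) ∧ y = X F ℓ Γ j0 (Pi.single 0 (2 : F)) 0) ∨
      ((∀ α ∈ Γ, α 0 = 0) ∧ y = X F ℓ Γ j0 0 (Pi.single 0 1))}

/-- The set `A₄`: `x^{2_{[p̄]}}` for `p ∈ I_{1,3}`, `t^{2_{[q̄]}}` for `q ∈ I_{4,6}`, plus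
`x^{−2_{[0]}}` if `Γ₀ ≠ {0}`. -/
def A4 (F : Type*) [Field F] (ℓ : ℕ → ℕ) (Γ : AddSubgroup (ℕ → F)) (j0 : Bool) :
    Set (CA F ℓ Γ j0) :=
  ((fun p => X F ℓ Γ j0 (Pi.single (bar ℓ p) (2 : F)) 0) '' ↑(iSet ℓ 1 3)) ∪
    ((fun q => X F ℓ Γ j0 0 (Pi.single (bar ℓ q) 2)) '' ↑(iSet ℓ 4 6)) ∪
    {y | (∃ α ∈ Γ, α 0 ≠ 0) ∧ y = X F ℓ Γ j0 (Pi.single 0 (-2 : F)) 0}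

section Helpers

set_option linter.unusedSimpArgs false

variable {F ℓ Γ j0}

/-! ### Index combinatorics -/

lemma iot_mono (ℓ : ℕ → ℕ) {a b : ℕ} (h : a ≤ b) : iot ℓ a ≤ iot ℓ b := by
  unfold iot
  exact Finset.sum_le_sum_of_subset (Finset.Icc_subset_Icc_right h)

lemma iot_zero (ℓ : ℕ → ℕ) : iot ℓ 0 = 0 := by simp [iot]

lemma iot_chain (ℓ : ℕ → ℕ) : iot ℓ 0 = 0 ∧ iot ℓ 1 ≤ iot ℓ 2 ∧ iot ℓ 2 ≤ iot ℓ 3 ∧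
    iot ℓ 3 ≤ iot ℓ 4 ∧ iot ℓ 4 ≤ iot ℓ 5 ∧ iot ℓ 5 ≤ iot ℓ 6 :=
  ⟨iot_zero ℓ, iot_mono ℓ (by norm_num), iot_mono ℓ (by norm_num), iot_mono ℓ (by norm_num),
    iot_mono ℓ (by norm_num), iot_mono ℓ (by norm_num)⟩

lemma mem_iSet {i j p : ℕ} : p ∈ iSet ℓ i j ↔ iot ℓ (i - 1) + 1 ≤ p ∧ p ≤ iot ℓ j := by
  simp [iSet]

lemma bar_of_le {p : ℕ} (h : p ≤ iot ℓ 6) : bar ℓ p = p + iot ℓ 6 := by simp [bar, h]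

lemma mem_barSet {i j p : ℕ} (hj : j ≤ 6) : p ∈ barSet ℓ (iSet ℓ i j) ↔
    iot ℓ (i - 1) + 1 + iot ℓ 6 ≤ p ∧ p ≤ iot ℓ j + iot ℓ 6 := by
  have h6 := iot_mono ℓ hj
  simp only [barSet, Finset.mem_image, mem_iSet]
  constructor
  · rintro ⟨q, ⟨h1, h2⟩, rfl⟩
    rw [bar_of_le (by omega)]
    omega
  · rintro ⟨h1, h2⟩
    refine ⟨p - iot ℓ 6, by omega, ?_⟩
    rw [bar_of_le (by omega)]
    omega

/-- Indices whose `t`-exponent is forced to vanish. -/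
lemma mem_jIdx {i : ℕ → ℕ} : i ∈ jIdx ℓ j0 ↔ (j0 = false → i 0 = 0) ∧
    ∀ p, 1 ≤ p → (p ≤ iot ℓ 2 ∨ (iot ℓ 3 < p ∧ p ≤ iot ℓ 4) ∨
      (iot ℓ 6 < p ∧ p ≤ iot ℓ 1 + iot ℓ 6) ∨ 2 * iot ℓ 6 < p) → i p = 0 := by
  have h0 := iot_zero ℓ
  simp only [jIdx, Set.mem_ofPred_eq]
  refine and_congr_right fun _ => forall_congr' fun p => forall_congr' fun hp => ?_
  have : (p ∈ iSet ℓ 1 2 ∪ iSet ℓ 4 4 ∪ barSet ℓ (iSet ℓ 1 1) ∨ 2 * iot ℓ 6 < p) ↔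
      (p ≤ iot ℓ 2 ∨ (iot ℓ 3 < p ∧ p ≤ iot ℓ 4) ∨
      (iot ℓ 6 < p ∧ p ≤ iot ℓ 1 + iot ℓ 6) ∨ 2 * iot ℓ 6 < p) := by
    simp only [Finset.mem_union, mem_iSet, mem_barSet (show 1 ≤ 6 by norm_num), iot_zero,
      Nat.sub_self, show 4 - 1 = 3 from rfl]
    omega
  rw [this]

lemma jIdx_zero : (0 : ℕ → ℕ) ∈ jIdx ℓ j0 := by simp [mem_jIdx]

lemma jIdx_add {i j : ℕ → ℕ} (hi : i ∈ jIdx ℓ j0) (hj : j ∈ jIdx ℓ j0) :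
    i + j ∈ jIdx ℓ j0 := by
  rw [mem_jIdx] at *
  refine ⟨fun h => by simp [hi.1 h, hj.1 h], fun p h1 h2 => by simp [hi.2 p h1 h2, hj.2 p h1 h2]⟩

lemma jIdx_down {i j : ℕ → ℕ} (hi : i ∈ jIdx ℓ j0) (hj : j ≤ i) : j ∈ jIdx ℓ j0 := by
  rw [mem_jIdx] at *
  refine ⟨fun h => ?_, fun p h1 h2 => ?_⟩
  · have := hj 0
    exact Nat.le_zero.mp (this.trans (hi.1 h).le)
  · have := hj p
    exact Nat.le_zero.mp (this.trans (hi.2 p h1 h2).le)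

lemma jIdx_sub {i : ℕ → ℕ} (hi : i ∈ jIdx ℓ j0) (j : ℕ → ℕ) : i - j ∈ jIdx ℓ j0 :=
  jIdx_down hi (fun p => by simp)

lemma jIdx_single {i : ℕ → ℕ} (hi : i ∈ jIdx ℓ j0) {p : ℕ} (hp : i p ≠ 0) :
    (Pi.single p 1 : ℕ → ℕ) ∈ jIdx ℓ j0 := by
  refine jIdx_down hi fun q => ?_
  by_cases h : q = p
  · subst h; simp; omega
  · simp [h]

lemma single_add_sub {i : ℕ → ℕ} {p : ℕ} (hp : i p ≠ 0) :
    (Pi.single p 1 : ℕ → ℕ) + (i - Pi.single p 1) = i := by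
  funext q
  by_cases h : q = p
  · subst h; simp; omega
  · simp [h]

/-! ### Linear versions of the operators -/

lemma X_mem {α : ℕ → F} {i : ℕ → ℕ} (hα : α ∈ Γ) (hi : i ∈ jIdx ℓ j0) :
    X F ℓ Γ j0 α i = Finsupp.single (⟨α, hα⟩, ⟨i, hi⟩) 1 := by
  unfold X; rw [dif_pos ⟨hα, hi⟩]

lemma ext_X {M : Type*} [AddCommMonoid M] [Module F M] {f g : CA F ℓ Γ j0 →ₗ[F] M}
    (h : ∀ α ∈ Γ, ∀ i ∈ jIdx ℓ j0, f (X F ℓ Γ j0 α i) = g (X F ℓ Γ j0 α i)) : f = g := by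
  refine Finsupp.lhom_ext' fun a => LinearMap.ext_ring ?_
  have := h a.1.1 a.1.2 a.2.1 a.2.2
  rw [X_mem a.1.2 a.2.2] at this
  exact this

def ptL (p : ℕ) : Module.End F (CA F ℓ Γ j0) :=
  Finsupp.linearCombination F
    (fun a => (a.2.1 p : F) • X F ℓ Γ j0 a.1.1 (a.2.1 - Pi.single p 1))

def shL (p : ℕ) : Module.End F (CA F ℓ Γ j0) :=
  Finsupp.linearCombination F (fun a => X F ℓ Γ j0 a.1.1 (a.2.1 + Pi.single p 1))

def dg (f : (ℕ → F) → (ℕ → ℕ) → F) : Module.End F (CA F ℓ Γ j0) :=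
  Finsupp.linearCombination F (fun a => f a.1.1 a.2.1 • Finsupp.single a 1)

def ddL (p : ℕ) : Module.End F (CA F ℓ Γ j0) := dg (fun α _ => α p) + ptL p

def mulL : CA F ℓ Γ j0 →ₗ[F] CA F ℓ Γ j0 →ₗ[F] CA F ℓ Γ j0 :=
  Finsupp.linearCombination F (fun a => Finsupp.linearCombination F
    (fun b => X F ℓ Γ j0 (a.1.1 + b.1.1) (a.2.1 + b.2.1)))

def degD (ℓ : ℕ → ℕ) (α : ℕ → F) (i : ℕ → ℕ) : F :=
  (∑ p ∈ jSet ℓ 1 3 ∪ iSet ℓ 4 5, α p) + ∑ p ∈ iSet ℓ 6 6 ∪ barSet ℓ (iSet ℓ 4 6), (i p : F)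

lemma pt_eq (p : ℕ) (u : CA F ℓ Γ j0) : pt F ℓ Γ j0 p u = ptL p u := by
  simp [pt, ptL, Finsupp.linearCombination_apply, smul_smul]

lemma pstar_eq (p : ℕ) (u : CA F ℓ Γ j0) :
    pstar F ℓ Γ j0 p u = dg (fun α _ => α p) u := by
  simp only [pstar, dg, Finsupp.linearCombination_apply, smul_smul]

lemma dd_eq (p : ℕ) (u : CA F ℓ Γ j0) : dd F ℓ Γ j0 p u = ddL p u := by
  simp [dd, ddL, pt_eq, pstar_eq]

lemma mulA_eq (u v : CA F ℓ Γ j0) : mulA F ℓ Γ j0 u v = mulL u v := by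
  simp only [mulA, mulL, Finsupp.linearCombination_apply, LinearMap.finsupp_sum_apply,
    LinearMap.smul_apply, Finsupp.smul_sum, smul_smul]

lemma ptL_X (p : ℕ) {α : ℕ → F} {i : ℕ → ℕ} (hα : α ∈ Γ) (hi : i ∈ jIdx ℓ j0) :
    ptL p (X F ℓ Γ j0 α i) = (i p : F) • X F ℓ Γ j0 α (i - Pi.single p 1) := by
  rw [X_mem hα hi, ptL, Finsupp.linearCombination_single, one_smul]

lemma shL_X (p : ℕ) {α : ℕ → F} {i : ℕ → ℕ} (hα : α ∈ Γ) (hi : i ∈ jIdx ℓ j0) :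
    shL p (X F ℓ Γ j0 α i) = X F ℓ Γ j0 α (i + Pi.single p 1) := by
  rw [X_mem hα hi, shL, Finsupp.linearCombination_single, one_smul]

lemma dg_X (f : (ℕ → F) → (ℕ → ℕ) → F) {α : ℕ → F} {i : ℕ → ℕ} (hα : α ∈ Γ)
    (hi : i ∈ jIdx ℓ j0) : dg f (X F ℓ Γ j0 α i) = f α i • X F ℓ Γ j0 α i := by
  rw [X_mem hα hi, dg, Finsupp.linearCombination_single, one_smul]

lemma mulL_X {α β : ℕ → F} {i j : ℕ → ℕ} (hα : α ∈ Γ) (hi : i ∈ jIdx ℓ j0)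
    (hβ : β ∈ Γ) (hj : j ∈ jIdx ℓ j0) :
    mulL (X F ℓ Γ j0 α i) (X F ℓ Γ j0 β j) = X F ℓ Γ j0 (α + β) (i + j) := by
  rw [X_mem hα hi, X_mem hβ hj, mulL, Finsupp.linearCombination_single, one_smul,
    Finsupp.linearCombination_single, one_smul]

lemma ddL_X (p : ℕ) {α : ℕ → F} {i : ℕ → ℕ} (hα : α ∈ Γ) (hi : i ∈ jIdx ℓ j0) :
    ddL p (X F ℓ Γ j0 α i) =
      α p • X F ℓ Γ j0 α i + (i p : F) • X F ℓ Γ j0 α (i - Pi.single p 1) := by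
  simp [ddL, dg_X _ hα hi, ptL_X _ hα hi]

lemma dg_apply (f : (ℕ → F) → (ℕ → ℕ) → F) (u : CA F ℓ Γ j0) (a : ↥Γ × ↥(jIdx ℓ j0)) :
    dg f u a = f a.1.1 a.2.1 * u a := by
  induction u using Finsupp.induction_linear with
  | zero => simp
  | add u v hu hv => simp [hu, hv, mul_add]
  | single b c =>
    simp only [dg, Finsupp.linearCombination_single, Finsupp.smul_apply, smul_eq_mul]
    by_cases h : b = a
    · subst h; simp [mul_comm]
    · simp [Finsupp.single_eq_of_ne' h]

lemma t_mul_pt (p : ℕ) (u : CA F ℓ Γ j0) :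
    mulL (X F ℓ Γ j0 0 (Pi.single p 1)) (ptL p u) = dg (fun _ i => (i p : F)) u := by
  have : (mulL (X F ℓ Γ j0 0 (Pi.single p 1))).comp (ptL p) = dg (fun _ i => (i p : F)) := by
    refine ext_X fun α hα i hi => ?_
    rw [LinearMap.comp_apply, ptL_X _ hα hi, dg_X _ hα hi, map_smul]
    by_cases h : i p = 0
    · simp [h]
    · rw [mulL_X Γ.zero_mem (jIdx_single hi h) hα (jIdx_sub hi _), zero_add, single_add_sub h]
  exact LinearMap.congr_fun this u

lemma Dop_eq (u : CA F ℓ Γ j0) : Dop F ℓ Γ j0 u = dg (degD ℓ) u := by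
  ext a
  simp only [Dop, pstar_eq, pt_eq, mulA_eq, t_mul_pt, Finsupp.add_apply, Finsupp.finsetSum_apply,
    dg_apply, degD, add_mul, Finset.sum_mul]

/-- The bracket as a bilinear map. -/
def brkL : CA F ℓ Γ j0 →ₗ[F] CA F ℓ Γ j0 →ₗ[F] CA F ℓ Γ j0 :=
  LinearMap.mk₂ F (fun u v =>
    (∑ p ∈ iSet ℓ 1 6, mulL (X F ℓ Γ j0 (sgm F ℓ p) 0)
      (mulL (ddL p u) (ddL (bar ℓ p) v) - mulL (ddL (bar ℓ p) u) (ddL p v))) +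
    mulL ((2 : F) • u - dg (degD ℓ) u) (ddL 0 v) -
    mulL (ddL 0 u) ((2 : F) • v - dg (degD ℓ) v))
  (fun u u' v => by
    simp only [map_add, map_sub, map_smul, LinearMap.add_apply, LinearMap.sub_apply,
      LinearMap.smul_apply, Finset.sum_add_distrib, Finset.sum_sub_distrib, smul_add]
    abel)
  (fun c u v => by
    simp only [map_add, map_sub, map_smul, LinearMap.add_apply, LinearMap.sub_apply,
      LinearMap.smul_apply, Finset.sum_sub_distrib, smul_add, smul_sub, Finset.smul_sum,
      smul_comm (2 : F) c])
  (fun u v v' => by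
    simp only [map_add, map_sub, map_smul, LinearMap.add_apply, LinearMap.sub_apply,
      LinearMap.smul_apply, Finset.sum_add_distrib, Finset.sum_sub_distrib, smul_add]
    abel)
  (fun c u v => by
    simp only [map_add, map_sub, map_smul, LinearMap.add_apply, LinearMap.sub_apply,
      LinearMap.smul_apply, Finset.sum_sub_distrib, smul_add, smul_sub, Finset.smul_sum,
      smul_comm (2 : F) c])

lemma brkL_apply (u v : CA F ℓ Γ j0) : brkL u v =
    (∑ p ∈ iSet ℓ 1 6, mulL (X F ℓ Γ j0 (sgm F ℓ p) 0)
      (mulL (ddL p u) (ddL (bar ℓ p) v) - mulL (ddL (bar ℓ p) u) (ddL p v))) +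
    mulL ((2 : F) • u - dg (degD ℓ) u) (ddL 0 v) -
    mulL (ddL 0 u) ((2 : F) • v - dg (degD ℓ) v) := rfl

lemma brk_eq (u v : CA F ℓ Γ j0) : brk F ℓ Γ j0 u v = brkL u v := by
  rw [brkL_apply]
  simp only [brk, dd_eq, mulA_eq, Dop_eq]

lemma mulL_comm (u v : CA F ℓ Γ j0) : mulL u v = mulL v u := by
  have : (mulL : CA F ℓ Γ j0 →ₗ[F] CA F ℓ Γ j0 →ₗ[F] CA F ℓ Γ j0) = mulL.flip := by
    refine ext_X fun α hα i hi => ext_X fun β hβ j hj => ?_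
    rw [LinearMap.flip_apply, mulL_X hα hi hβ hj, mulL_X hβ hj hα hi, add_comm α, add_comm i]
  exact LinearMap.congr_fun (LinearMap.congr_fun this u) v

lemma brkL_anti (u v : CA F ℓ Γ j0) : brkL u v = - brkL v u := by
  rw [brkL_apply, brkL_apply]
  rw [mulL_comm (ddL 0 u), mulL_comm (ddL 0 v), ← sub_eq_zero]
  have : ∀ p ∈ iSet ℓ 1 6, mulL (X F ℓ Γ j0 (sgm F ℓ p) 0)
      (mulL (ddL p u) (ddL (bar ℓ p) v) - mulL (ddL (bar ℓ p) u) (ddL p v)) =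
      - mulL (X F ℓ Γ j0 (sgm F ℓ p) 0)
      (mulL (ddL p v) (ddL (bar ℓ p) u) - mulL (ddL (bar ℓ p) v) (ddL p u)) := by
    intro p _
    rw [← map_neg, mulL_comm (ddL p u), mulL_comm (ddL p v), neg_sub]
  rw [Finset.sum_congr rfl this, Finset.sum_neg_distrib]
  abel

/-- Multiplication by `x^{α,i}` then `x^{β,j}`. -/
lemma mulL_mulL {α β : ℕ → F} {i j : ℕ → ℕ} (hα : α ∈ Γ) (hi : i ∈ jIdx ℓ j0)
    (hβ : β ∈ Γ) (hj : j ∈ jIdx ℓ j0) (u : CA F ℓ Γ j0) :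
    mulL (X F ℓ Γ j0 α i) (mulL (X F ℓ Γ j0 β j) u) = mulL (X F ℓ Γ j0 (α + β) (i + j)) u := by
  have : (mulL (X F ℓ Γ j0 α i)).comp (mulL (X F ℓ Γ j0 β j)) =
      mulL (X F ℓ Γ j0 (α + β) (i + j)) := by
    refine ext_X fun γ hγ k hk => ?_
    rw [LinearMap.comp_apply, mulL_X hβ hj hγ hk,
      mulL_X hα hi (Γ.add_mem hβ hγ) (jIdx_add hj hk),
      mulL_X (Γ.add_mem hα hβ) (jIdx_add hi hj) hγ hk, add_assoc, add_assoc]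
  exact LinearMap.congr_fun this u

lemma mulL_one (u : CA F ℓ Γ j0) : mulL (X F ℓ Γ j0 0 0) u = u := by
  have : mulL (X F ℓ Γ j0 0 0) = LinearMap.id := by
    refine ext_X fun γ hγ k hk => ?_
    rw [mulL_X Γ.zero_mem jIdx_zero hγ hk]; simp
  exact LinearMap.congr_fun this u

lemma mulL_cancel {α : ℕ → F} (hα : α ∈ Γ) {u : CA F ℓ Γ j0}
    (h : mulL (X F ℓ Γ j0 α 0) u = 0) : u = 0 := by
  have := mulL_mulL (Γ.neg_mem hα) (jIdx_zero (ℓ := ℓ) (j0 := j0)) hα jIdx_zero u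
  rw [h, map_zero, neg_add_cancel, add_zero, mulL_one] at this
  exact this.symm

/-! ### Abstract linear algebra -/

section Abstract

variable {K V : Type*} [Field K] [AddCommGroup V] [Module K V]

/-- Solve `(L + N) u = w` inside an invariant submodule `W`. -/
lemma solve_nil [CharZero K] (W : Submodule K V) (L G N T : Module.End K V)
    (hL : ∀ v ∈ W, L v ∈ W) (hG : ∀ v ∈ W, G v ∈ W) (hN : ∀ v ∈ W, N v ∈ W)
    (hT : ∀ v ∈ W, T v ∈ W)
    (hLGL : ∀ v, L (G (L v)) = L v) (hLG : ∀ v, L (G v) = G (L v))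
    (hLN : ∀ v, L (N v) = N (L v)) (hLT : ∀ v, L (T v) = T (L v))
    (hGN : ∀ v, G (N v) = N (G v))
    (hNT : ∀ v, N (T v) = T (N v) + v)
    (hnil : ∀ v, ∃ m : ℕ, (N ^ m) v = 0) (w : V) (hw : w ∈ W) :
    ∃ u ∈ W, L u + N u = w := by
  have hNTk : ∀ (k : ℕ) (v : V), N ((T ^ (k + 1)) v) = (T ^ (k + 1)) (N v) + (k + 1 : K) • (T ^ k) v := by
    intro k
    induction k with
    | zero => intro v; simp [hNT]
    | succ k ih =>
      intro v
      rw [pow_succ', Module.End.mul_apply, hNT, ih, map_add, map_smul, pow_succ' T k,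
        Module.End.mul_apply, Module.End.mul_apply, ← Module.End.mul_apply T (T ^ k),
        ← pow_succ', add_assoc]
      congr 1
      push_cast
      module
  have hTkW : ∀ (k : ℕ), ∀ v ∈ W, (T ^ k) v ∈ W := by
    intro k
    induction k with
    | zero => intro v hv; simpa using hv
    | succ k ih => intro v hv; rw [pow_succ', Module.End.mul_apply]; exact hT _ (ih v hv)
  have hLTk : ∀ (k : ℕ) (v : V), L ((T ^ k) v) = (T ^ k) (L v) := by
    intro k
    induction k with
    | zero => intro v; simp
    | succ k ih => intro v; rw [pow_succ', Module.End.mul_apply, hLT, ih, Module.End.mul_apply]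
  have hA : ∀ (m : ℕ), ∀ v ∈ W, (N ^ m) v = 0 → ∃ u ∈ W, L u + N u = L (G v) := by
    intro m
    induction m with
    | zero =>
      intro v hv h
      have : v = 0 := by simpa using h
      exact ⟨0, W.zero_mem, by simp [this]⟩
    | succ m ih =>
      intro v hv h
      have hpow : ∀ (m : ℕ) (v : V), G ((N ^ m) v) = (N ^ m) (G v) := by
        intro m
        induction m with
        | zero => intro v; simp
        | succ m ih => intro v; rw [pow_succ', Module.End.mul_apply, hGN, ih, Module.End.mul_apply]
      obtain ⟨u, hu, hu'⟩ := ih (N (G v)) (hN _ (hG _ hv)) (by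
        rw [← Module.End.mul_apply, ← pow_succ, ← hpow, h, map_zero])
      -- `(L+N) (G L G v) = L G v + N L G G v`
      refine ⟨L (G (G v)) - u, W.sub_mem (hL _ (hG _ (hG _ hv))) hu, ?_⟩
      rw [map_sub, map_sub]
      have e1 : L (L (G (G v))) = L (G v) := by rw [hLG (G v), hLGL]
      have e2 : N (L (G (G v))) = L (G (N (G v))) := by rw [hGN, hLN]
      rw [e1, e2, ← hu']; abel
  have hB : ∀ (m : ℕ), ∀ v ∈ W, (N ^ m) v = 0 → L v = 0 → ∀ k : ℕ,
      ∃ u ∈ W, L u + N u = (T ^ k) v := by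
    intro m
    induction m with
    | zero =>
      intro v hv h _ k
      have : v = 0 := by simpa using h
      exact ⟨0, W.zero_mem, by simp [this]⟩
    | succ m ih =>
      intro v hv h hLv k
      obtain ⟨u, hu, hu'⟩ := ih (N v) (hN _ hv) (by rw [← Module.End.mul_apply, ← pow_succ, h])
        (by rw [hLN, hLv, map_zero]) (k + 1)
      have hk : (k + 1 : K) ≠ 0 := by exact_mod_cast Nat.succ_ne_zero k
      refine ⟨(k + 1 : K)⁻¹ • ((T ^ (k + 1)) v - u),
        W.smul_mem _ (W.sub_mem (hTkW _ _ hv) hu), ?_⟩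
      rw [map_smul, map_smul, ← smul_add, map_sub, map_sub, hLTk, hLv, map_zero, hNTk, ← hu',
        show 0 - L u + (L u + N u + (k + 1 : K) • (T ^ k) v - N u) = (k + 1 : K) • (T ^ k) v by abel,
        smul_smul, inv_mul_cancel₀ hk, one_smul]
  obtain ⟨m, hm⟩ := hnil w
  obtain ⟨u1, h1, h1'⟩ := hA m w hw hm
  have hw2 : w - L (G w) ∈ W := W.sub_mem hw (hL _ (hG _ hw))
  obtain ⟨m', hm'⟩ := hnil (w - L (G w))
  obtain ⟨u2, h2, h2'⟩ := hB m' _ hw2 hm' (by rw [map_sub, hLG w, hLGL, sub_self]) 0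
  refine ⟨u1 + u2, W.add_mem h1 h2, ?_⟩
  rw [map_add, map_add, show L u1 + L u2 + (N u1 + N u2) = (L u1 + N u1) + (L u2 + N u2) by abel,
    h1', h2']
  simp

/-- Solving a compatible finite system of equations for commuting operators. -/
lemma solve_system {ι : Type*} [DecidableEq ι] (S : Finset ι) (D : ι → Module.End K V) (w : ι → V)
    (hcomm : ∀ a ∈ S, ∀ b ∈ S, ∀ v, D a (D b v) = D b (D a v))
    (hcompat : ∀ a ∈ S, ∀ b ∈ S, D a (w b) = D b (w a))
    (R : ι → Submodule K V) (hwR : ∀ a ∈ S, w a ∈ R a) (hDR : ∀ a ∈ S, ∀ v, D a v ∈ R a)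
    (hsolve : ∀ a ∈ S, ∀ S' ⊆ S, a ∉ S' → ∀ v ∈ R a, (∀ b ∈ S', D b v = 0) →
      ∃ u, (∀ b ∈ S', D b u = 0) ∧ D a u = v) :
    ∃ u, ∀ a ∈ S, D a u = w a := by
  suffices H : ∀ S' : Finset ι, S' ⊆ S → ∃ u, ∀ a ∈ S', D a u = w a from H S (Finset.Subset.refl S)
  intro S'
  induction S' using Finset.induction_on with
  | empty => intro _; exact ⟨0, by simp⟩
  | insert a S' ha ih =>
    intro hS
    have haS : a ∈ S := hS (Finset.mem_insert_self _ _)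
    have hS' : S' ⊆ S := fun x hx => hS (Finset.mem_insert_of_mem hx)
    obtain ⟨u, hu⟩ := ih hS'
    obtain ⟨u', hu1, hu2⟩ := hsolve a haS S' hS' ha (w a - D a u)
      ((R a).sub_mem (hwR a haS) (hDR a haS u)) (by
        intro b hb
        rw [map_sub, hcomm b (hS' hb) a haS, hu b hb, hcompat b (hS' hb) a haS, sub_self])
    refine ⟨u + u', fun b hb => ?_⟩
    rcases Finset.mem_insert.mp hb with rfl | hb
    · rw [map_add, hu2]; abel
    · rw [map_add, hu b hb, hu1 b hb, add_zero]

end Abstract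

/-! ### Weights, nilpotent parts, shifts -/

lemma dg_dg (f g : (ℕ → F) → (ℕ → ℕ) → F) (v : CA F ℓ Γ j0) :
    dg f (dg g v) = dg (fun α i => f α i * g α i) v := by
  ext a; simp only [dg_apply, mul_assoc]

lemma dg_dg_comm (f g : (ℕ → F) → (ℕ → ℕ) → F) (v : CA F ℓ Γ j0) :
    dg f (dg g v) = dg g (dg f v) := by
  ext a; simp only [dg_apply]; ring

lemma dg_ptL (f : (ℕ → F) → (ℕ → ℕ) → F) (q : ℕ)
    (h : ∀ α ∈ Γ, ∀ i ∈ jIdx ℓ j0, i q ≠ 0 → f α (i - Pi.single q 1) = f α i)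
    (v : CA F ℓ Γ j0) : dg f (ptL q v) = ptL q (dg f v) := by
  have : (dg f).comp (ptL q) = (ptL q).comp (dg (Γ := Γ) (ℓ := ℓ) (j0 := j0) f) := by
    refine ext_X fun α hα i hi => ?_
    simp only [LinearMap.comp_apply, ptL_X _ hα hi, dg_X _ hα hi, map_smul,
      dg_X _ hα (jIdx_sub hi _)]
    by_cases h0 : i q = 0
    · simp [h0]
    · rw [h α hα i hi h0, smul_comm]
  exact LinearMap.congr_fun this v

lemma dg_shL (f : (ℕ → F) → (ℕ → ℕ) → F) (q : ℕ)
    (hq : (Pi.single q 1 : ℕ → ℕ) ∈ jIdx ℓ j0)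
    (h : ∀ α ∈ Γ, ∀ i ∈ jIdx ℓ j0, f α (i + Pi.single q 1) = f α i)
    (v : CA F ℓ Γ j0) : dg f (shL q v) = shL q (dg f v) := by
  have : (dg f).comp (shL q) = (shL q).comp (dg (Γ := Γ) (ℓ := ℓ) (j0 := j0) f) := by
    refine ext_X fun α hα i hi => ?_
    simp only [LinearMap.comp_apply, shL_X _ hα hi, dg_X _ hα hi, map_smul,
      dg_X _ hα (jIdx_add hi hq)]
    rw [h α hα i hi]
  exact LinearMap.congr_fun this v

lemma ptL_comm (p q : ℕ) (v : CA F ℓ Γ j0) : ptL p (ptL q v) = ptL q (ptL p v) := by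
  have : (ptL p).comp (ptL q) = (ptL q).comp (ptL (F := F) (Γ := Γ) (ℓ := ℓ) (j0 := j0) p) := by
    refine ext_X fun α hα i hi => ?_
    simp only [LinearMap.comp_apply, ptL_X _ hα hi, map_smul, ptL_X _ hα (jIdx_sub hi _)]
    by_cases h : p = q
    · subst h; rfl
    · simp [h, Ne.symm h, smul_smul, mul_comm, tsub_right_comm (a := i) (b := Pi.single p 1)]
  exact LinearMap.congr_fun this v

lemma ptL_shL_ne {p q : ℕ} (hpq : p ≠ q) (hq : (Pi.single q 1 : ℕ → ℕ) ∈ jIdx ℓ j0)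
    (v : CA F ℓ Γ j0) : ptL p (shL q v) = shL q (ptL p v) := by
  have : (ptL p).comp (shL q) = (shL q).comp (ptL (F := F) (Γ := Γ) (ℓ := ℓ) (j0 := j0) p) := by
    refine ext_X fun α hα i hi => ?_
    simp only [LinearMap.comp_apply, shL_X _ hα hi, ptL_X _ hα hi, map_smul,
      shL_X _ hα (jIdx_sub hi _), ptL_X _ hα (jIdx_add hi hq)]
    simp only [Pi.add_apply, Pi.single_eq_of_ne hpq, add_zero]
    congr 2
    funext r
    by_cases h1 : r = p
    · subst h1; simp [hpq]
    · simp [h1]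
  exact LinearMap.congr_fun this v

lemma ptL_shL_self {q : ℕ} (hq : (Pi.single q 1 : ℕ → ℕ) ∈ jIdx ℓ j0)
    (v : CA F ℓ Γ j0) : ptL q (shL q v) = shL q (ptL q v) + v := by
  have : (ptL q).comp (shL q) =
      (shL q).comp (ptL (F := F) (Γ := Γ) (ℓ := ℓ) (j0 := j0) q) + LinearMap.id := by
    refine ext_X fun α hα i hi => ?_
    simp only [LinearMap.comp_apply, LinearMap.add_apply, LinearMap.id_apply, shL_X _ hα hi,
      ptL_X _ hα hi, map_smul, shL_X _ hα (jIdx_sub hi _), ptL_X _ hα (jIdx_add hi hq)]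
    rw [add_tsub_cancel_right]
    by_cases h : i q = 0
    · simp [h]
    · rw [add_comm (i - Pi.single q 1), single_add_sub h]
      simp [add_smul]
  exact LinearMap.congr_fun this v

lemma ptL_eq_zero {q : ℕ} (h : ∀ i ∈ jIdx ℓ j0, i q = 0) :
    (ptL q : Module.End F (CA F ℓ Γ j0)) = 0 := by
  refine ext_X fun α hα i hi => ?_
  simp [ptL_X _ hα hi, h i hi]

/-- Local nilpotency of `a ∂_{t_r} + b ∂_{t_s}`. -/
lemma nil_pt (a b : F) (r s : ℕ) (v : CA F ℓ Γ j0) :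
    ∃ m : ℕ, ((a • ptL r + b • ptL s : Module.End F (CA F ℓ Γ j0)) ^ m) v = 0 := by
  set N : Module.End F (CA F ℓ Γ j0) := a • ptL r + b • ptL s with hN
  have key : ∀ n : ℕ, ∀ α ∈ Γ, ∀ i ∈ jIdx ℓ j0, i r + i s < n → (N ^ n) (X F ℓ Γ j0 α i) = 0 := by
    intro n
    induction n with
    | zero => intro α _ i _ h; omega
    | succ n ih =>
      intro α hα i hi h
      rw [pow_succ, Module.End.mul_apply]
      have e : N (X F ℓ Γ j0 α i) = a • (i r : F) • X F ℓ Γ j0 α (i - Pi.single r 1) +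
          b • (i s : F) • X F ℓ Γ j0 α (i - Pi.single s 1) := by
        simp [hN, ptL_X _ hα hi]
      rw [e, map_add, map_smul, map_smul, map_smul, map_smul]
      have e1 : (i r : F) • (N ^ n) (X F ℓ Γ j0 α (i - Pi.single r 1)) = 0 := by
        by_cases h0 : i r = 0
        · simp [h0]
        · rw [ih α hα _ (jIdx_sub hi _), smul_zero]
          have : (i - Pi.single r 1 : ℕ → ℕ) s ≤ i s := by simp
          simp only [Pi.sub_apply, Pi.single_eq_same] at *
          omega
      have e2 : (i s : F) • (N ^ n) (X F ℓ Γ j0 α (i - Pi.single s 1)) = 0 := by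
        by_cases h0 : i s = 0
        · simp [h0]
        · rw [ih α hα _ (jIdx_sub hi _), smul_zero]
          have : (i - Pi.single s 1 : ℕ → ℕ) r ≤ i r := by simp
          simp only [Pi.sub_apply, Pi.single_eq_same] at *
          omega
      rw [e1, e2]; simp
  have mono : ∀ (m n : ℕ) (u : CA F ℓ Γ j0), m ≤ n → (N ^ m) u = 0 → (N ^ n) u = 0 := by
    intro m n u h h0
    obtain ⟨k, rfl⟩ := Nat.exists_eq_add_of_le' h
    rw [pow_add, Module.End.mul_apply, h0, map_zero]
  induction v using Finsupp.induction_linear with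
  | zero => exact ⟨0, by simp⟩
  | add u v hu hv =>
    obtain ⟨m, hm⟩ := hu
    obtain ⟨n, hn⟩ := hv
    refine ⟨max m n, ?_⟩
    rw [map_add, mono _ _ _ (le_max_left m n) hm, mono _ _ _ (le_max_right m n) hn, add_zero]
  | single c x =>
    refine ⟨c.2.1 r + c.2.1 s + 1, ?_⟩
    have := key (c.2.1 r + c.2.1 s + 1) c.1.1 c.1.2 c.2.1 c.2.2 (by omega)
    rw [X_mem c.1.2 c.2.2] at this
    have e : (Finsupp.single c x : CA F ℓ Γ j0) = x • Finsupp.single c 1 := by simp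
    rw [e, map_smul]
    erw [this]
    simp

/-- The weight of the semisimple part of `ad y_p`. -/
def lamW (ℓ : ℕ → ℕ) (p : ℕ) (α : ℕ → F) (i : ℕ → ℕ) : F :=
  if p = 0 then 2 * α 0
  else if p ≤ iot ℓ 3 then α (p + iot ℓ 6) - α p
  else if p ≤ iot ℓ 5 then (i (p + iot ℓ 6) : F) - α p
  else (i (p + iot ℓ 6) : F) - (i p : F)

def pb (ℓ : ℕ → ℕ) (p : ℕ) : ℕ := if p = 0 then 0 else p + iot ℓ 6

def cA (F : Type*) [Field F] (ℓ : ℕ → ℕ) (p : ℕ) : F :=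
  if p = 0 then 2 else if p ≤ iot ℓ 3 then 1 else 0

def cB (F : Type*) [Field F] (ℓ : ℕ → ℕ) (p : ℕ) : F :=
  if p = 0 then 0 else if p ≤ iot ℓ 5 then -1 else 0

/-- The nilpotent part of `ad y_p`. -/
def NL (p : ℕ) : Module.End F (CA F ℓ Γ j0) := cA F ℓ p • ptL (pb ℓ p) + cB F ℓ p • ptL p

def DL (p : ℕ) : Module.End F (CA F ℓ Γ j0) := dg (lamW ℓ p) + NL p

lemma DL_apply (p : ℕ) (v : CA F ℓ Γ j0) : DL p v = dg (lamW ℓ p) v + NL p v := rfl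

lemma NL_apply (p : ℕ) (v : CA F ℓ Γ j0) :
    NL p v = cA F ℓ p • ptL (pb ℓ p) v + cB F ℓ p • ptL p v := rfl

/-- Indices in which the nilpotent parts live. -/
def nilIdx (ℓ : ℕ → ℕ) (q : ℕ) : Prop :=
  q ≤ iot ℓ 5 ∨ (iot ℓ 6 < q ∧ q ≤ iot ℓ 6 + iot ℓ 3)

lemma lamW_congr {p q : ℕ} (hp : p ≤ iot ℓ 6) (hq : nilIdx ℓ q) (α : ℕ → F) {i j : ℕ → ℕ}
    (h : ∀ r, r ≠ q → i r = j r) : lamW ℓ p α i = lamW ℓ p α j := by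
  have hc := iot_chain ℓ
  unfold lamW
  unfold nilIdx at hq
  split_ifs with h1 h2 h3
  · rfl
  · rfl
  · rw [h _ (by omega)]
  · rw [h _ (by omega), h _ (by omega)]

lemma dgl_ptL (f : F → F) {p q : ℕ} (hp : p ≤ iot ℓ 6) (hq : nilIdx ℓ q) (v : CA F ℓ Γ j0) :
    dg (fun α i => f (lamW ℓ p α i)) (ptL q v) = ptL q (dg (fun α i => f (lamW ℓ p α i)) v) := by
  refine dg_ptL _ q (fun α _ i _ _ => ?_) v
  rw [lamW_congr hp hq α (j := i)]
  intro r hr; simp [hr]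

lemma dgl_shL (f : F → F) {p q : ℕ} (hp : p ≤ iot ℓ 6) (hq : nilIdx ℓ q)
    (hq' : (Pi.single q 1 : ℕ → ℕ) ∈ jIdx ℓ j0) (v : CA F ℓ Γ j0) :
    dg (fun α i => f (lamW ℓ p α i)) (shL q v) = shL q (dg (fun α i => f (lamW ℓ p α i)) v) := by
  refine dg_shL _ q hq' (fun α _ i _ => ?_) v
  rw [lamW_congr hp hq α (j := i)]
  intro r hr; simp [hr]

lemma dgl_NL (f : F → F) {p q : ℕ} (hp : p ≤ iot ℓ 6) (v : CA F ℓ Γ j0) :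
    dg (fun α i => f (lamW ℓ p α i)) (NL q v) = NL q (dg (fun α i => f (lamW ℓ p α i)) v) := by
  have hc := iot_chain ℓ
  rw [NL_apply, NL_apply, map_add, map_smul, map_smul]
  congr 1
  · by_cases h : q = 0 ∨ q ≤ iot ℓ 3
    · rw [dgl_ptL f hp]
      unfold nilIdx pb
      split_ifs <;> omega
    · have : cA F ℓ q = 0 := by
        unfold cA; rw [if_neg (by tauto), if_neg (by tauto)]
      simp [this]
  · by_cases h : q ≤ iot ℓ 5
    · rw [dgl_ptL f hp]
      unfold nilIdx; omega
    · have : cB F ℓ q = 0 := by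
        unfold cB; simp [h]
      simp [this]

lemma NL_comm (p q : ℕ) (v : CA F ℓ Γ j0) : NL p (NL q v) = NL q (NL p v) := by
  simp only [NL_apply, map_add, map_smul, ptL_comm p, ptL_comm (pb ℓ p), smul_add]
  simp only [smul_comm (cA F ℓ p), smul_comm (cB F ℓ p)]
  abel

lemma DL_comm_dg (f : F → F) {p q : ℕ} (hp : p ≤ iot ℓ 6) (v : CA F ℓ Γ j0) :
    dg (fun α i => f (lamW ℓ p α i)) (DL q v) = DL q (dg (fun α i => f (lamW ℓ p α i)) v) := by
  rw [DL_apply, DL_apply, map_add, dg_dg_comm, dgl_NL f hp]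

lemma DL_comm_NL {p q : ℕ} (hp : p ≤ iot ℓ 6) (v : CA F ℓ Γ j0) :
    NL q (DL p v) = DL p (NL q v) := by
  rw [DL_apply, DL_apply, map_add, NL_comm p q]
  congr 1
  exact (dgl_NL (fun x => x) hp v).symm

lemma DL_comm {p q : ℕ} (hp : p ≤ iot ℓ 6) (hq : q ≤ iot ℓ 6) (v : CA F ℓ Γ j0) :
    DL p (DL q v) = DL q (DL p v) := by
  rw [DL_apply q (DL p v), DL_comm_NL hp]
  rw [show dg (lamW ℓ q) (DL p v) = DL p (dg (lamW ℓ q) v) from DL_comm_dg (fun x => x) hq v]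
  rw [← map_add, ← DL_apply]

/-! ### The elements `y_p` and their adjoint action -/

/-- The hypotheses on `Γ`, in numerical form. -/
structure Hyp (F : Type*) [Field F] (ℓ : ℕ → ℕ) (Γ : AddSubgroup (ℕ → F)) (j0 : Bool) : Prop where
  h1 : ∀ p, 1 ≤ p → p ≤ iot ℓ 5 → (Pi.single p (1 : F) : ℕ → F) ∈ Γ
  h1b : ∀ p, iot ℓ 6 < p → p ≤ iot ℓ 6 + iot ℓ 3 → (Pi.single p (1 : F) : ℕ → F) ∈ Γ
  h2 : ∀ α ∈ Γ, ∀ p, iot ℓ 5 < p → p ≤ iot ℓ 6 → α p = 0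
  h2b : ∀ α ∈ Γ, ∀ p, iot ℓ 6 + iot ℓ 3 < p → p ≤ 2 * iot ℓ 6 → α p = 0
  h0 : j0 = false → (Pi.single 0 (1 : F) : ℕ → F) ∈ Γ

lemma mem_S1 {p : ℕ} : p ∈ jSet ℓ 1 3 ∪ iSet ℓ 4 5 ↔
    (1 ≤ p ∧ p ≤ iot ℓ 5) ∨ (iot ℓ 6 < p ∧ p ≤ iot ℓ 6 + iot ℓ 3) := by
  have hc := iot_chain ℓ
  simp only [jSet, Finset.mem_union, mem_iSet, mem_barSet (show 3 ≤ 6 by norm_num), Nat.sub_self,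
    show 4 - 1 = 3 from rfl]
  omega

lemma mem_S2 {p : ℕ} : p ∈ iSet ℓ 6 6 ∪ barSet ℓ (iSet ℓ 4 6) ↔
    (iot ℓ 5 < p ∧ p ≤ iot ℓ 6) ∨ (iot ℓ 6 + iot ℓ 3 < p ∧ p ≤ 2 * iot ℓ 6) := by
  have hc := iot_chain ℓ
  simp only [Finset.mem_union, mem_iSet, mem_barSet (show 6 ≤ 6 by norm_num),
    show 4 - 1 = 3 from rfl, show 6 - 1 = 5 from rfl]
  omega

lemma sgm_zero_of {p : ℕ} (h : p = 0 ∨ iot ℓ 5 < p) (hp : p ≤ iot ℓ 6) : sgm F ℓ p = 0 := by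
  have hc := iot_chain ℓ
  unfold sgm
  simp only [hp, if_true, mem_iSet, Nat.sub_self, show 4 - 1 = 3 from rfl]
  rw [if_neg (by omega), if_neg (by omega)]

lemma sgm_13 {p : ℕ} (h : 1 ≤ p) (h3 : p ≤ iot ℓ 3) :
    sgm F ℓ p = -Pi.single p (1 : F) - Pi.single (p + iot ℓ 6) (1 : F) := by
  have hc := iot_chain ℓ
  unfold sgm
  simp only [show p ≤ iot ℓ 6 by omega, if_true, mem_iSet, Nat.sub_self, show 4 - 1 = 3 from rfl]
  rw [if_pos (by omega)]

lemma sgm_45 {p : ℕ} (h : iot ℓ 3 < p) (h3 : p ≤ iot ℓ 5) :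
    sgm F ℓ p = -Pi.single p (1 : F) := by
  have hc := iot_chain ℓ
  unfold sgm
  simp only [show p ≤ iot ℓ 6 by omega, if_true, mem_iSet, Nat.sub_self, show 4 - 1 = 3 from rfl]
  rw [if_neg (by omega), if_pos (by omega)]

lemma sgm_mem (H : Hyp F ℓ Γ j0) {p : ℕ} (hp : p ≤ iot ℓ 6) : sgm F ℓ p ∈ Γ := by
  by_cases h : p = 0 ∨ iot ℓ 5 < p
  · rw [sgm_zero_of h hp]; exact Γ.zero_mem
  · by_cases h3 : p ≤ iot ℓ 3
    · rw [sgm_13 (by omega) h3]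
      exact Γ.sub_mem (Γ.neg_mem (H.h1 p (by omega) (by omega))) (H.h1b _ (by omega) (by omega))
    · rw [sgm_45 (by omega) (by omega)]
      exact Γ.neg_mem (H.h1 p (by omega) (by omega))

lemma single_mem_jIdx {q : ℕ} (h0 : q = 0 → j0 = true)
    (h : 1 ≤ q → iot ℓ 2 < q ∧ (q ≤ iot ℓ 3 ∨ iot ℓ 4 < q) ∧
      (q ≤ iot ℓ 6 ∨ iot ℓ 1 + iot ℓ 6 < q) ∧ q ≤ 2 * iot ℓ 6) :
    (Pi.single q 1 : ℕ → ℕ) ∈ jIdx ℓ j0 := by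
  rw [mem_jIdx]
  constructor
  · intro hj
    have : q ≠ 0 := by rintro rfl; simp [hj] at h0
    simp [Ne.symm this]
  · intro p hp hp'
    have : p ≠ q := by
      rintro rfl
      have := h hp
      omega
    simp [this]

lemma single_bar_mem {p : ℕ} (hp : iot ℓ 1 < p) (h6 : p ≤ iot ℓ 6) :
    (Pi.single (p + iot ℓ 6) 1 : ℕ → ℕ) ∈ jIdx ℓ j0 := by
  have hc := iot_chain ℓ
  exact single_mem_jIdx (by omega) (by omega)

lemma brkL_local {p : ℕ} (hp : 1 ≤ p) (hp6 : p ≤ iot ℓ 6) (u v : CA F ℓ Γ j0)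
    (hq : ∀ q, q ≠ p → q ≠ p + iot ℓ 6 → ddL q u = 0)
    (h2 : mulL ((2 : F) • u - dg (degD ℓ) u) (ddL 0 v) = 0) :
    brkL u v = mulL (X F ℓ Γ j0 (sgm F ℓ p) 0)
      (mulL (ddL p u) (ddL (p + iot ℓ 6) v) - mulL (ddL (p + iot ℓ 6) u) (ddL p v)) := by
  have hc := iot_chain ℓ
  rw [brkL_apply, h2, hq 0 (by omega) (by omega), Finset.sum_eq_single p]
  · rw [bar_of_le hp6]; simp
  · intro q hq' hne
    rw [mem_iSet] at hq'
    rw [bar_of_le hq'.2, hq q hne (by omega), hq (q + iot ℓ 6) (by omega) (by omega)]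
    simp
  · intro h
    exact absurd (mem_iSet.mpr (by simp only [Nat.sub_self]; omega)) h

def yi (ℓ : ℕ → ℕ) (p : ℕ) : ℕ → ℕ :=
  if p ≤ iot ℓ 3 then 0
  else if p ≤ iot ℓ 5 then Pi.single (p + iot ℓ 6) 1
  else Pi.single p 1 + Pi.single (p + iot ℓ 6) 1

def Y (F : Type*) [Field F] (ℓ : ℕ → ℕ) (Γ : AddSubgroup (ℕ → F)) (j0 : Bool) (p : ℕ) :
    CA F ℓ Γ j0 := X F ℓ Γ j0 (-sgm F ℓ p) (yi ℓ p)

lemma degD_single {p : ℕ} (h : (1 ≤ p ∧ p ≤ iot ℓ 5) ∨ (iot ℓ 6 < p ∧ p ≤ iot ℓ 6 + iot ℓ 3)) :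
    ∑ q ∈ jSet ℓ 1 3 ∪ iSet ℓ 4 5, (Pi.single p (1 : F) : ℕ → F) q = 1 := by
  have := mem_S1.mpr h
  rw [Finset.sum_pi_single', if_pos this]

lemma degD_single' {p : ℕ}
    (h : (iot ℓ 5 < p ∧ p ≤ iot ℓ 6) ∨ (iot ℓ 6 + iot ℓ 3 < p ∧ p ≤ 2 * iot ℓ 6)) :
    ∑ q ∈ iSet ℓ 6 6 ∪ barSet ℓ (iSet ℓ 4 6), (((Pi.single p 1 : ℕ → ℕ) q : ℕ) : F) = 1 := by
  have := mem_S2.mpr h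
  rw [← Nat.cast_sum, Finset.sum_pi_single', if_pos this, Nat.cast_one]

lemma brkL_Y (H : Hyp F ℓ Γ j0) {p : ℕ} (hp : p ≤ iot ℓ 6) (v : CA F ℓ Γ j0) :
    brkL (Y F ℓ Γ j0 p) v = DL p v := by
  have hc := iot_chain ℓ
  have hz : (0 : ℕ → ℕ) ∈ jIdx ℓ j0 := jIdx_zero
  by_cases h0 : p = 0
  · subst h0
    have hY : Y F ℓ Γ j0 0 = X F ℓ Γ j0 0 0 := by
      simp [Y, sgm_zero_of (F := F) (ℓ := ℓ) (Or.inl rfl) (Nat.zero_le _), yi]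
    have hd : ∀ q, ddL q (Y F ℓ Γ j0 0) = 0 := by
      intro q; rw [hY, ddL_X q Γ.zero_mem hz]; simp
    rw [brkL_apply]
    simp only [hd]
    have hdeg : dg (degD ℓ) (Y F ℓ Γ j0 0) = 0 := by
      rw [hY, dg_X _ Γ.zero_mem hz]; simp [degD]
    rw [hdeg, hY]
    simp only [map_zero, LinearMap.zero_apply, sub_zero, Finset.sum_const_zero, zero_add, map_smul,
      LinearMap.smul_apply, mulL_one]
    rw [DL_apply, NL_apply]
    simp only [cA, cB, pb, if_true, zero_smul, add_zero]
    have : dg (lamW ℓ 0) v = (2 : F) • dg (fun α _ => α 0) v := by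
      ext a; simp [dg_apply, lamW, mul_assoc]
    rw [this, ← smul_add]
    rfl
  have hp1 : 1 ≤ p := by omega
  by_cases h3 : p ≤ iot ℓ 3
  · have hs := H.h1 p hp1 (by omega)
    have hsb := H.h1b (p + iot ℓ 6) (by omega) (by omega)
    have hα := Γ.add_mem hs hsb
    have hY : Y F ℓ Γ j0 p =
        X F ℓ Γ j0 (Pi.single p (1 : F) + Pi.single (p + iot ℓ 6) (1 : F)) 0 := by
      simp only [Y, yi, h3, if_true, sgm_13 hp1 h3]
      congr 1; abel
    have hd : ∀ q, ddL q (Y F ℓ Γ j0 p) =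
        ((Pi.single p (1 : F) + Pi.single (p + iot ℓ 6) (1 : F) : ℕ → F) q) • Y F ℓ Γ j0 p := by
      intro q; rw [hY, ddL_X q hα hz]; simp
    have hdeg : dg (degD ℓ) (Y F ℓ Γ j0 p) = (2 : F) • Y F ℓ Γ j0 p := by
      rw [hY, dg_X _ hα hz]
      congr 1
      simp only [degD, Pi.add_apply, Finset.sum_add_distrib]
      rw [degD_single (by omega), degD_single (by omega)]
      simp; norm_num
    rw [brkL_local hp1 hp _ _ _ (by rw [hdeg]; simp)]
    · have e1 : ddL p (Y F ℓ Γ j0 p) = Y F ℓ Γ j0 p := by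
        rw [hd]; simp [Pi.single_eq_of_ne (show p ≠ p + iot ℓ 6 by omega)]
      have e2 : ddL (p + iot ℓ 6) (Y F ℓ Γ j0 p) = Y F ℓ Γ j0 p := by
        rw [hd]; simp [Pi.single_eq_of_ne (show p + iot ℓ 6 ≠ p by omega)]
      rw [e1, e2, ← map_sub, hY, mulL_mulL (sgm_mem H hp) hz hα hz, sgm_13 hp1 h3]
      rw [show (-Pi.single p (1 : F) - Pi.single (p + iot ℓ 6) (1 : F) +
        (Pi.single p (1 : F) + Pi.single (p + iot ℓ 6) (1 : F)) : ℕ → F) = 0 by abel, add_zero,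
        mulL_one, DL_apply, NL_apply]
      simp only [cA, cB, pb, h0, h3, if_true, if_false, show p ≤ iot ℓ 5 by omega]
      have : dg (lamW ℓ p) v = dg (fun α _ => α (p + iot ℓ 6)) v - dg (fun α _ => α p) v := by
        ext a; simp [dg_apply, lamW, h0, h3, sub_mul]
      rw [this, ddL, ddL, LinearMap.add_apply, LinearMap.add_apply]
      simp only [one_smul, neg_smul]
      abel
    · intro q h1 h2
      rw [hd]; simp [h1, h2]
  by_cases h5 : p ≤ iot ℓ 5
  · have hs := H.h1 p hp1 (by omega)
    have ht : (Pi.single (p + iot ℓ 6) 1 : ℕ → ℕ) ∈ jIdx ℓ j0 := single_bar_mem (by omega) hp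
    have hY : Y F ℓ Γ j0 p =
        X F ℓ Γ j0 (Pi.single p (1 : F)) (Pi.single (p + iot ℓ 6) 1) := by
      simp only [Y, yi, h3, h5, if_true, if_false, sgm_45 (F := F) (show iot ℓ 3 < p by omega) h5,
        neg_neg]
    have hd : ∀ q, ddL q (Y F ℓ Γ j0 p) = (Pi.single p (1 : F) : ℕ → F) q • Y F ℓ Γ j0 p +
        (((Pi.single (p + iot ℓ 6) 1 : ℕ → ℕ) q : ℕ) : F) • X F ℓ Γ j0 (Pi.single p (1 : F))
          (Pi.single (p + iot ℓ 6) 1 - Pi.single q 1) := by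
      intro q; rw [hY, ddL_X q hs ht]
    have hdeg : dg (degD ℓ) (Y F ℓ Γ j0 p) = (2 : F) • Y F ℓ Γ j0 p := by
      rw [hY, dg_X _ hs ht]
      congr 1
      simp only [degD]
      rw [degD_single (by omega), degD_single' (by omega)]
      norm_num
    rw [brkL_local hp1 hp _ _ _ (by rw [hdeg]; simp)]
    · have e1 : ddL p (Y F ℓ Γ j0 p) = Y F ℓ Γ j0 p := by
        rw [hd]; simp [Pi.single_eq_of_ne (show p ≠ p + iot ℓ 6 by omega)]
      have e2 : ddL (p + iot ℓ 6) (Y F ℓ Γ j0 p) = X F ℓ Γ j0 (Pi.single p (1 : F)) 0 := by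
        rw [hd]; simp [Pi.single_eq_of_ne (show p + iot ℓ 6 ≠ p by omega)]
      rw [e1, e2, map_sub, hY, mulL_mulL (sgm_mem H hp) hz hs ht,
        mulL_mulL (sgm_mem H hp) hz hs hz,
        sgm_45 (show iot ℓ 3 < p by omega) h5, neg_add_cancel, zero_add, zero_add,
        mulL_one, DL_apply, NL_apply]
      simp only [cA, cB, pb, h0, h3, h5, if_true, if_false]
      have e3 : dg (fun α _ => α (p + iot ℓ 6)) v = 0 := by
        ext a
        rw [dg_apply, H.h2b a.1.1 a.1.2 (p + iot ℓ 6) (by omega) (by omega)]; simp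
      have : dg (lamW ℓ p) v = dg (fun _ i => (i (p + iot ℓ 6) : F)) v - dg (fun α _ => α p) v := by
        ext a; simp [dg_apply, lamW, h0, h3, h5, sub_mul]
      rw [this, ddL, ddL, LinearMap.add_apply, LinearMap.add_apply, e3, zero_add, t_mul_pt]
      simp only [zero_smul, neg_smul, one_smul]
      abel
    · intro q h1 h2
      rw [hd]; simp [h1, h2]
  · have ht : (Pi.single (p + iot ℓ 6) 1 : ℕ → ℕ) ∈ jIdx ℓ j0 := single_bar_mem (by omega) hp
    have ht' : (Pi.single p 1 : ℕ → ℕ) ∈ jIdx ℓ j0 := single_mem_jIdx (by omega) (by omega)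
    have hs := Γ.zero_mem
    have htt := jIdx_add ht' ht
    have hY : Y F ℓ Γ j0 p =
        X F ℓ Γ j0 0 (Pi.single p 1 + Pi.single (p + iot ℓ 6) 1) := by
      simp only [Y, yi, h3, h5, if_false, sgm_zero_of (F := F) (Or.inr (show iot ℓ 5 < p by omega)) hp,
        neg_zero]
    have hd : ∀ q, ddL q (Y F ℓ Γ j0 p) =
        (((Pi.single p 1 + Pi.single (p + iot ℓ 6) 1 : ℕ → ℕ) q : ℕ) : F) • X F ℓ Γ j0 0
          (Pi.single p 1 + Pi.single (p + iot ℓ 6) 1 - Pi.single q 1) := by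
      intro q; rw [hY, ddL_X q hs htt]; simp
    have hdeg : dg (degD ℓ) (Y F ℓ Γ j0 p) = (2 : F) • Y F ℓ Γ j0 p := by
      rw [hY, dg_X _ hs htt]
      congr 1
      simp only [degD, Pi.add_apply, Nat.cast_add, Finset.sum_add_distrib]
      rw [degD_single' (by omega), degD_single' (by omega)]
      simp; norm_num
    rw [brkL_local hp1 hp _ _ _ (by rw [hdeg]; simp)]
    · have e1 : ddL p (Y F ℓ Γ j0 p) = X F ℓ Γ j0 0 (Pi.single (p + iot ℓ 6) 1) := by
        rw [hd, add_tsub_cancel_left]; simp [Pi.single_eq_of_ne (show p ≠ p + iot ℓ 6 by omega)]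
      have e2 : ddL (p + iot ℓ 6) (Y F ℓ Γ j0 p) = X F ℓ Γ j0 0 (Pi.single p 1) := by
        rw [hd, add_tsub_cancel_right]; simp [Pi.single_eq_of_ne (show p + iot ℓ 6 ≠ p by omega)]
      rw [e1, e2, sgm_zero_of (F := F) (Or.inr (show iot ℓ 5 < p by omega)) hp,
        mulL_one, DL_apply, NL_apply]
      simp only [cA, cB, pb, h0, h3, h5, if_true, if_false]
      have e3 : dg (fun α _ => α (p + iot ℓ 6)) v = 0 := by
        ext a
        rw [dg_apply, H.h2b a.1.1 a.1.2 (p + iot ℓ 6) (by omega) (by omega)]; simp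
      have e4 : dg (fun α _ => α p) v = 0 := by
        ext a
        rw [dg_apply, H.h2 a.1.1 a.1.2 p (by omega) (by omega)]; simp
      have : dg (lamW ℓ p) v = dg (fun _ i => (i (p + iot ℓ 6) : F)) v -
          dg (fun _ i => (i p : F)) v := by
        ext a; simp [dg_apply, lamW, h0, h3, h5, sub_mul]
      rw [this, ddL, ddL, LinearMap.add_apply, LinearMap.add_apply, e3, e4, zero_add, zero_add,
        t_mul_pt, t_mul_pt]
      simp
    · intro q h1 h2
      rw [hd]; simp [h1, h2]

/-! ### The centre is trivial -/

lemma DL_zero (v : CA F ℓ Γ j0) : DL 0 v = (2 : F) • ddL 0 v := by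
  rw [DL_apply, NL_apply]
  simp only [cA, cB, pb, if_true, zero_smul, add_zero]
  have : dg (lamW ℓ 0) v = (2 : F) • dg (fun α _ => α 0) v := by
    ext a; simp [dg_apply, lamW, mul_assoc]
  rw [this, ← smul_add]
  rfl

/-- Either the exponential or the polynomial variable in direction `r` is available. -/
lemma probe_x {r : ℕ} (h : (Pi.single r (1 : F) : ℕ → F) ∈ Γ) :
    ∃ (v : CA F ℓ Γ j0) (g : ℕ → F), g ∈ Γ ∧ ddL r v = X F ℓ Γ j0 g 0 ∧
      ∀ s, s ≠ r → ddL s v = 0 := by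
  refine ⟨X F ℓ Γ j0 (Pi.single r (1 : F)) 0, _, h, ?_, fun s hs => ?_⟩
  · rw [ddL_X r h jIdx_zero]; simp
  · rw [ddL_X s h jIdx_zero]; simp [hs]

lemma probe_t {r : ℕ} (h : (Pi.single r 1 : ℕ → ℕ) ∈ jIdx ℓ j0) :
    ∃ (v : CA F ℓ Γ j0) (g : ℕ → F), g ∈ Γ ∧ ddL r v = X F ℓ Γ j0 g 0 ∧
      ∀ s, s ≠ r → ddL s v = 0 := by
  refine ⟨X F ℓ Γ j0 0 (Pi.single r 1), _, Γ.zero_mem, ?_, fun s hs => ?_⟩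
  · rw [ddL_X r Γ.zero_mem h]; simp
  · rw [ddL_X s Γ.zero_mem h]; simp [hs]

lemma probe (H : Hyp F ℓ Γ j0) {r : ℕ} (hr : r ≤ 2 * iot ℓ 6) :
    ∃ (v : CA F ℓ Γ j0) (g : ℕ → F), g ∈ Γ ∧ ddL r v = X F ℓ Γ j0 g 0 ∧
      ∀ s, s ≠ r → ddL s v = 0 := by
  have hc := iot_chain ℓ
  by_cases h0 : r = 0
  · subst h0
    cases hj : j0
    · subst hj; exact probe_x (H.h0 rfl)
    · exact probe_t (single_mem_jIdx (fun _ => rfl) (by omega))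
  by_cases h5 : r ≤ iot ℓ 5
  · exact probe_x (H.h1 r (by omega) h5)
  by_cases h6 : r ≤ iot ℓ 6
  · exact probe_t (single_mem_jIdx (by omega) (by omega))
  by_cases h3 : r ≤ iot ℓ 6 + iot ℓ 3
  · exact probe_x (H.h1b r (by omega) h3)
  · exact probe_t (single_mem_jIdx (by omega) (by omega))

lemma ddL_split {r : ℕ} {z : CA F ℓ Γ j0} (h : ddL r z = 0) :
    dg (fun α _ => α r) z = 0 ∧ ptL r z = 0 := by
  have h' : dg (fun α _ => α r) z = - ptL r z := by
    rw [ddL, LinearMap.add_apply] at h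
    exact eq_neg_of_add_eq_zero_left h
  obtain ⟨m, hm⟩ := nil_pt (-1 : F) 0 r r z
  have key : ∀ k : ℕ, (((-1 : F) • ptL r + (0 : F) • ptL r : Module.End F (CA F ℓ Γ j0)) ^ k) z =
      dg (fun α _ => α r ^ k) z := by
    intro k
    induction k with
    | zero => ext a; simp [dg_apply]
    | succ k ih =>
      rw [pow_succ', Module.End.mul_apply, ih]
      simp only [LinearMap.add_apply, LinearMap.smul_apply, zero_smul, add_zero, neg_smul, one_smul]
      rw [← dg_ptL (fun α _ => α r ^ k) r (fun _ _ _ _ _ => rfl), ← map_neg, ← h', dg_dg]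
      simp only [pow_succ]
  have h1 : dg (fun α _ => α r) z = 0 := by
    ext a
    have := DFunLike.congr_fun ((key m).symm.trans hm) a
    rw [dg_apply] at this ⊢
    simp only [Finsupp.zero_apply, mul_eq_zero] at this ⊢
    rcases this with h | h
    · exact Or.inl (IsReduced.eq_zero _ ⟨m, h⟩)
    · exact Or.inr h
  refine ⟨h1, ?_⟩
  rw [h1] at h'
  exact (neg_eq_zero.mp h'.symm)

lemma center [CharZero F] (H : Hyp F ℓ Γ j0) {z : CA F ℓ Γ j0} (hz : ∀ v, brkL v z = 0) :
    z = 0 := by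
  have hc := iot_chain ℓ
  have h0 : ddL 0 z = 0 := by
    have := hz (Y F ℓ Γ j0 0)
    rw [brkL_Y H (Nat.zero_le _), DL_zero] at this
    exact (smul_eq_zero.mp this).resolve_left two_ne_zero
  have hall : ∀ r, r ≤ 2 * iot ℓ 6 → ddL r z = 0 := by
    intro r hr
    by_cases hr0 : r = 0
    · subst hr0; exact h0
    by_cases h6 : r ≤ iot ℓ 6
    · obtain ⟨v, g, hg, hv, hs⟩ := probe H (r := r + iot ℓ 6) (by omega)
      have := hz v
      rw [brkL_local (p := r) (by omega) h6 v z (fun q _ hq => hs q hq) (by rw [h0, map_zero]),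
        hv, hs r (by omega), map_zero, LinearMap.zero_apply, zero_sub] at this
      have := mulL_cancel (sgm_mem H h6) this
      exact mulL_cancel hg (neg_eq_zero.mp this)
    · obtain ⟨p, rfl⟩ : ∃ p, r = p + iot ℓ 6 := ⟨r - iot ℓ 6, by omega⟩
      obtain ⟨v, g, hg, hv, hs⟩ := probe H (r := p) (by omega)
      have := hz v
      rw [brkL_local (p := p) (by omega) (by omega) v z (fun q hq _ => hs q hq)
        (by rw [h0, map_zero]),
        hv, hs (p + iot ℓ 6) (by omega), map_zero, LinearMap.zero_apply, sub_zero] at this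
      have := mulL_cancel (sgm_mem H (by omega)) this
      exact mulL_cancel hg this
  have h2 : (2 : F) • z - dg (degD ℓ) z = 0 := by
    obtain ⟨v, g, hg, hv, hs⟩ := probe H (r := 0) (by omega)
    have := hz v
    rw [brkL_apply, h0, hv, map_zero, Finset.sum_eq_zero, zero_add, zero_sub] at this
    · exact mulL_cancel hg (neg_eq_zero.mp this)
    · intro q hq
      rw [mem_iSet] at hq
      rw [hs q (by omega), bar_of_le hq.2, hs (q + iot ℓ 6) (by omega)]
      simp
  have h3 : dg (degD ℓ) z = 0 := by
    rw [← Dop_eq, Dop]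
    rw [Finset.sum_eq_zero, Finset.sum_eq_zero, add_zero]
    · intro p hp
      rw [mem_S2] at hp
      rw [mulA_eq, pt_eq, (ddL_split (hall p (by omega))).2, map_zero]
    · intro p hp
      rw [mem_S1] at hp
      rw [pstar_eq, (ddL_split (hall p (by omega))).1]
  rw [h3, sub_zero] at h2
  exact (smul_eq_zero.mp h2).resolve_left two_ne_zero

/-! ### The weight operators are derivations of the bracket -/

lemma lamW_add (p : ℕ) (α β : ℕ → F) (i j : ℕ → ℕ) :
    lamW ℓ p (α + β) (i + j) = lamW ℓ p α i + lamW ℓ p β j := by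
  unfold lamW
  split_ifs <;> simp only [Pi.add_apply, Nat.cast_add] <;> ring

lemma E_mul (p : ℕ) (u v : CA F ℓ Γ j0) :
    dg (lamW ℓ p) (mulL u v) = mulL (dg (lamW ℓ p) u) v + mulL u (dg (lamW ℓ p) v) := by
  have : (mulL : CA F ℓ Γ j0 →ₗ[F] CA F ℓ Γ j0 →ₗ[F] CA F ℓ Γ j0).compr₂ (dg (lamW ℓ p)) =
      mulL.comp (dg (lamW ℓ p)) + mulL.compl₂ (dg (lamW ℓ p)) := by
    refine ext_X fun α hα i hi => ext_X fun β hβ j hj => ?_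
    simp only [LinearMap.compr₂_apply, LinearMap.add_apply, LinearMap.comp_apply,
      LinearMap.compl₂_apply, dg_X _ hα hi, dg_X _ hβ hj, mulL_X hα hi hβ hj, map_smul,
      LinearMap.smul_apply, dg_X _ (Γ.add_mem hα hβ) (jIdx_add hi hj), lamW_add, add_smul]
  exact LinearMap.congr_fun (LinearMap.congr_fun this u) v

/-- Minus the coefficient of `i_q` in the weight `lamW p`. -/
def aW (F : Type*) [Field F] (ℓ : ℕ → ℕ) (p q : ℕ) : F :=
  if p ≤ iot ℓ 3 then 0
  else if p ≤ iot ℓ 5 then (if q = p + iot ℓ 6 then -1 else 0)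
  else (if q = p + iot ℓ 6 then -1 else if q = p then 1 else 0)

lemma aW_mul (H : Hyp F ℓ Γ j0) {p q : ℕ} (hp : p ≤ iot ℓ 6) {α : ℕ → F} (hα : α ∈ Γ) :
    aW F ℓ p q * α q = 0 := by
  have hc := iot_chain ℓ
  unfold aW
  split_ifs with h1 h2 h3 h4 h5
  · simp
  · rw [H.h2b α hα q (by omega) (by omega)]; simp
  · simp
  · rw [H.h2b α hα q (by omega) (by omega)]; simp
  · rw [H.h2 α hα q (by omega) (by omega)]; simp
  · simp

lemma lamW_sub {p q : ℕ} (hp : p ≤ iot ℓ 6) (α : ℕ → F) {i : ℕ → ℕ} (hi : i q ≠ 0) :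
    lamW ℓ p α (i - Pi.single q 1) = lamW ℓ p α i + aW F ℓ p q := by
  have hc := iot_chain ℓ
  have key : ∀ r, (((i - Pi.single q 1 : ℕ → ℕ) r : ℕ) : F) = (i r : F) - if q = r then 1 else 0 := by
    intro r
    split_ifs with h
    · subst h
      simp [Nat.cast_sub (Nat.one_le_iff_ne_zero.mpr hi)]
    · simp [Pi.single_eq_of_ne (Ne.symm h)]
  unfold lamW aW
  by_cases h0 : p = 0
  · subst h0; simp
  by_cases h3 : p ≤ iot ℓ 3
  · simp [h0, h3]
  by_cases h5 : p ≤ iot ℓ 5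
  · simp only [h0, h3, h5, if_true, if_false, key]
    split_ifs <;> ring
  · simp only [h0, h3, h5, if_true, if_false, key]
    split_ifs <;> first | omega | ring

lemma E_dd (H : Hyp F ℓ Γ j0) {p : ℕ} (hp : p ≤ iot ℓ 6) (q : ℕ) (v : CA F ℓ Γ j0) :
    dg (lamW ℓ p) (ddL q v) = ddL q (dg (lamW ℓ p) v) + aW F ℓ p q • ddL q v := by
  have : (dg (lamW ℓ p)).comp (ddL q) =
      (ddL q).comp (dg (lamW ℓ p)) + aW F ℓ p q • (ddL q : Module.End F (CA F ℓ Γ j0)) := by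
    refine ext_X fun α hα i hi => ?_
    simp only [LinearMap.comp_apply, LinearMap.add_apply, LinearMap.smul_apply, dg_X _ hα hi,
      map_smul, ddL_X q hα hi, map_add, dg_X _ hα (jIdx_sub hi _)]
    have h1 : aW F ℓ p q • α q • X F ℓ Γ j0 α i = 0 := by
      rw [smul_smul, aW_mul H hp hα, zero_smul]
    rw [smul_add, smul_add, h1, zero_add]
    by_cases h0 : i q = 0
    · simp only [h0, Nat.cast_zero, zero_smul, smul_zero, add_zero]
      exact smul_comm _ _ _
    · rw [lamW_sub hp α h0]
      module
  exact LinearMap.congr_fun this v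

lemma lamW_sgm {p q : ℕ} (hp : p ≤ iot ℓ 6) (hq1 : 1 ≤ q) (hq : q ≤ iot ℓ 6) :
    lamW ℓ p (sgm F ℓ q) 0 = -(aW F ℓ p q + aW F ℓ p (q + iot ℓ 6)) := by
  have hc := iot_chain ℓ
  have s1 : ∀ r, sgm F ℓ q r = if q ≤ iot ℓ 3 then
      ((if r = q then -1 else 0) - (if r = q + iot ℓ 6 then 1 else 0)) else
      if q ≤ iot ℓ 5 then (if r = q then -1 else 0) else 0 := by
    intro r
    split_ifs with h3 _ _ _ h5
    all_goals first
      | rw [sgm_13 hq1 h3]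
      | rw [sgm_45 (by omega) h5]
      | rw [sgm_zero_of (by omega) hq]
    all_goals simp [Pi.single_apply, *]
    all_goals omega
  unfold lamW aW
  simp only [s1, Pi.zero_apply, Nat.cast_zero]
  split_ifs <;> first | omega | ring

lemma E_brk (H : Hyp F ℓ Γ j0) {p : ℕ} (hp : p ≤ iot ℓ 6) (u v : CA F ℓ Γ j0) :
    dg (lamW ℓ p) (brkL u v) = brkL (dg (lamW ℓ p) u) v + brkL u (dg (lamW ℓ p) v) := by
  have hc := iot_chain ℓ
  have a0 : aW F ℓ p 0 = 0 := by
    unfold aW; split_ifs <;> first | omega | rfl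
  have hdd0 : ∀ w : CA F ℓ Γ j0, dg (lamW ℓ p) (ddL 0 w) = ddL 0 (dg (lamW ℓ p) w) := by
    intro w; rw [E_dd H hp, a0]; simp
  have hsum : ∀ q ∈ iSet ℓ 1 6, dg (lamW ℓ p) (mulL (X F ℓ Γ j0 (sgm F ℓ q) 0)
      (mulL (ddL q u) (ddL (bar ℓ q) v) - mulL (ddL (bar ℓ q) u) (ddL q v))) =
      mulL (X F ℓ Γ j0 (sgm F ℓ q) 0)
      (mulL (ddL q (dg (lamW ℓ p) u)) (ddL (bar ℓ q) v) -
        mulL (ddL (bar ℓ q) (dg (lamW ℓ p) u)) (ddL q v)) +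
      mulL (X F ℓ Γ j0 (sgm F ℓ q) 0)
      (mulL (ddL q u) (ddL (bar ℓ q) (dg (lamW ℓ p) v)) -
        mulL (ddL (bar ℓ q) u) (ddL q (dg (lamW ℓ p) v))) := by
    intro q hq
    rw [mem_iSet] at hq
    rw [bar_of_le hq.2, E_mul, dg_X _ (sgm_mem H hq.2) jIdx_zero, lamW_sgm hp (by omega) hq.2,
      map_sub (dg (lamW ℓ p) : Module.End F (CA F ℓ Γ j0)), E_mul, E_mul]
    simp only [E_dd H hp, map_add, map_sub, map_smul, LinearMap.add_apply, LinearMap.smul_apply]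
    module
  rw [brkL_apply, brkL_apply, brkL_apply]
  rw [map_sub (dg (lamW ℓ p) : Module.End F (CA F ℓ Γ j0)), map_add (dg (lamW ℓ p) : Module.End F (CA F ℓ Γ j0)), map_sum, Finset.sum_congr rfl hsum,
    Finset.sum_add_distrib, E_mul, E_mul, hdd0, hdd0, map_sub (dg (lamW ℓ p) : Module.End F (CA F ℓ Γ j0)),
    map_sub (dg (lamW ℓ p) : Module.End F (CA F ℓ Γ j0)), map_smul, map_smul, dg_dg_comm (lamW ℓ p) (degD ℓ),
    dg_dg_comm (lamW ℓ p) (degD ℓ)]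
  abel

lemma dg_inv (f : (ℕ → F) → (ℕ → ℕ) → F) (v : CA F ℓ Γ j0) :
    dg f (dg (fun α i => (f α i)⁻¹) (dg f v)) = dg f v := by
  ext a; simp only [dg_apply]
  by_cases h : f a.1.1 a.2.1 = 0
  · simp [h]
  · field_simp

/-- For a semisimple label the value of a derivation lies in the range of `ad y_p`. -/
lemma range_semi [CharZero F] (H : Hyp F ℓ Γ j0) {p : ℕ} (hp : p ≤ iot ℓ 6)
    (hN : (NL p : Module.End F (CA F ℓ Γ j0)) = 0) (d : CA F ℓ Γ j0 →ₗ[F] CA F ℓ Γ j0)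
    (hd : ∀ u v, d (brkL u v) = brkL (d u) v + brkL u (d v)) :
    ∃ x, d (Y F ℓ Γ j0 p) = dg (lamW ℓ p) x := by
  set E : Module.End F (CA F ℓ Γ j0) := dg (lamW ℓ p) with hE
  have hEY : ∀ v, brkL (Y F ℓ Γ j0 p) v = E v := by
    intro v; rw [brkL_Y H hp, DL_apply, hN]; simp [hE]
  set z := d (Y F ℓ Γ j0 p) with hz
  set z' := dg (fun α i => (lamW ℓ p α i)⁻¹) z with hz'
  have hz0 : E (z - E z') = 0 := by
    rw [map_sub, sub_eq_zero, hz', hE, dg_dg_comm (lamW ℓ p) (fun α i => (lamW ℓ p α i)⁻¹), dg_inv]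
  refine ⟨z', sub_eq_zero.mp (center H fun v => ?_)⟩
  rw [brkL_anti, neg_eq_zero]
  have : brkL (z - E z') = 0 := by
    refine ext_X fun α hα i hi => ?_
    set y := X F ℓ Γ j0 α i with hy
    have hEy : E y = lamW ℓ p α i • y := dg_X _ hα hi
    set lam := lamW ℓ p α i
    have h1 : brkL z y = lam • d y - E (d y) := by
      have := hd (Y F ℓ Γ j0 p) y
      rw [hEY, hEY, hEy, map_smul] at this
      rw [this]; abel
    have h2 : brkL (E z') y = E (brkL z' y) - lam • brkL z' y := by
      have := E_brk H hp z' y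
      rw [← hE, hEy, map_smul] at this
      rw [this]; abel
    have h3 : E (brkL (z - E z') y) = lam • brkL (z - E z') y := by
      have := E_brk H hp (z - E z') y
      rw [← hE, hEy, hz0, map_smul] at this
      rw [this]; simp
    have h4 : brkL (z - E z') y = lam • (d y + brkL z' y) - E (d y + brkL z' y) := by
      rw [map_sub, LinearMap.sub_apply, h1, h2, map_add, smul_add]; abel
    rw [LinearMap.zero_apply]
    ext a
    have h3' := DFunLike.congr_fun h3 a
    have h4' := DFunLike.congr_fun h4 a
    rw [hE, dg_apply] at h3'
    rw [hE] at h4'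
    simp only [Finsupp.sub_apply, Finsupp.smul_apply, smul_eq_mul] at h3' h4'
    rw [dg_apply, ← sub_mul] at h4'
    simp only [Finsupp.zero_apply]
    by_cases hl : lam - lamW ℓ p a.1.1 a.2.1 = 0
    · rw [h4', hl, zero_mul]
    · have : (lam - lamW ℓ p a.1.1 a.2.1) * (brkL (z - dg (lamW ℓ p) z') y) a = 0 := by
        rw [sub_mul, h3']; simp [hE]
      exact (mul_eq_zero.mp this).resolve_left hl
  rw [this, LinearMap.zero_apply]

/-! ### Commutation of the elements `y_p` -/

lemma yi_apply (b r : ℕ) : yi ℓ b r = if b ≤ iot ℓ 3 then 0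
    else if b ≤ iot ℓ 5 then (if r = b + iot ℓ 6 then 1 else 0)
    else ((if r = b then 1 else 0) + (if r = b + iot ℓ 6 then 1 else 0)) := by
  unfold yi
  by_cases h3 : b ≤ iot ℓ 3
  · simp only [h3, if_true, Pi.zero_apply]
  by_cases h5 : b ≤ iot ℓ 5
  · simp only [h3, h5, if_true, if_false, Pi.single_apply]
  · simp only [h3, h5, if_false, Pi.add_apply, Pi.single_apply]

lemma yi_mem {b : ℕ} (hb : b ≤ iot ℓ 6) : yi ℓ b ∈ jIdx ℓ j0 := by
  have hc := iot_chain ℓ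
  unfold yi
  split_ifs with h3 h5
  · exact jIdx_zero
  · exact single_bar_mem (by omega) hb
  · exact jIdx_add (single_mem_jIdx (by omega) (by omega)) (single_bar_mem (by omega) hb)

lemma sgm_apply {q : ℕ} (hq : q ≤ iot ℓ 6) (r : ℕ) : sgm F ℓ q r = if q = 0 then 0 else
    if q ≤ iot ℓ 3 then
      ((if r = q then -1 else 0) - (if r = q + iot ℓ 6 then 1 else 0)) else
      if q ≤ iot ℓ 5 then (if r = q then -1 else 0) else 0 := by
  have hc := iot_chain ℓ
  by_cases h0 : q = 0
  · rw [sgm_zero_of (Or.inl h0) hq]; simp [h0]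
  by_cases h3 : q ≤ iot ℓ 3
  · rw [sgm_13 (by omega) h3]
    simp only [h0, h3, if_true, if_false, Pi.sub_apply, Pi.neg_apply, Pi.single_apply]
    split_ifs <;> simp
  by_cases h5 : q ≤ iot ℓ 5
  · rw [sgm_45 (by omega) h5]
    simp only [h0, h3, h5, if_true, if_false, Pi.neg_apply, Pi.single_apply]
    split_ifs <;> simp
  · rw [sgm_zero_of (by omega) hq]; simp [h0, h3, h5]

lemma lamW_Y {a b : ℕ} (ha : a ≤ iot ℓ 6) (hb : b ≤ iot ℓ 6) :
    lamW ℓ a (-sgm F ℓ b) (yi ℓ b) = 0 := by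
  have hc := iot_chain ℓ
  unfold lamW
  simp only [Pi.neg_apply, sgm_apply hb, yi_apply]
  split_ifs <;> first | omega | (push_cast; ring)

lemma DL_Y (H : Hyp F ℓ Γ j0) {a b : ℕ} (ha : a ≤ iot ℓ 6) (hb : b ≤ iot ℓ 6) :
    DL a (Y F ℓ Γ j0 b) = 0 := by
  have hc := iot_chain ℓ
  have hs := Γ.neg_mem (sgm_mem H hb)
  have hy : yi ℓ b ∈ jIdx ℓ j0 := yi_mem hb
  rw [DL_apply, NL_apply, Y, dg_X _ hs hy, lamW_Y ha hb, zero_smul, zero_add, ptL_X _ hs hy,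
    ptL_X _ hs hy]
  have h1 : cA F ℓ a * (yi ℓ b (pb ℓ a) : F) = 0 := by
    rw [yi_apply]; unfold cA pb
    split_ifs <;> first | omega | simp
  have h2 : cB F ℓ a * (yi ℓ b a : F) = 0 := by
    rw [yi_apply]; unfold cB
    split_ifs <;> first | omega | simp
  rw [smul_smul, smul_smul, h1, h2]; simp

lemma compat (H : Hyp F ℓ Γ j0) {a b : ℕ} (ha : a ≤ iot ℓ 6) (hb : b ≤ iot ℓ 6)
    (d : CA F ℓ Γ j0 →ₗ[F] CA F ℓ Γ j0)
    (hd : ∀ u v, d (brkL u v) = brkL (d u) v + brkL u (d v)) :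
    DL a (d (Y F ℓ Γ j0 b)) = DL b (d (Y F ℓ Γ j0 a)) := by
  have h := hd (Y F ℓ Γ j0 a) (Y F ℓ Γ j0 b)
  rw [brkL_Y H ha, brkL_Y H ha, DL_Y H ha hb, map_zero, brkL_anti, brkL_Y H hb] at h
  rw [← sub_eq_zero, h]; abel

/-! ### Semisimple and non-semisimple labels -/

def semi (ℓ : ℕ → ℕ) (j0 : Bool) (p : ℕ) : Prop :=
  (p = 0 ∧ j0 = false) ∨ (1 ≤ p ∧ p ≤ iot ℓ 1) ∨ (iot ℓ 3 < p ∧ p ≤ iot ℓ 4) ∨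
    (iot ℓ 5 < p ∧ p ≤ iot ℓ 6)

lemma NL_semi {p : ℕ} (h : semi ℓ j0 p) : (NL p : Module.End F (CA F ℓ Γ j0)) = 0 := by
  have hc := iot_chain ℓ
  rcases h with ⟨rfl, hj⟩ | ⟨h1, h2⟩ | ⟨h1, h2⟩ | ⟨h1, h2⟩
  · have : (ptL 0 : Module.End F (CA F ℓ Γ j0)) = 0 :=
      ptL_eq_zero fun i hi => (mem_jIdx.mp hi).1 hj
    rw [NL, pb, if_pos rfl, this]; simp
  · have e1 : (ptL p : Module.End F (CA F ℓ Γ j0)) = 0 :=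
      ptL_eq_zero fun i hi => (mem_jIdx.mp hi).2 p h1 (by omega)
    have e2 : (ptL (p + iot ℓ 6) : Module.End F (CA F ℓ Γ j0)) = 0 :=
      ptL_eq_zero fun i hi => (mem_jIdx.mp hi).2 (p + iot ℓ 6) (by omega) (by omega)
    rw [NL, pb, if_neg (by omega), e1, e2]; simp
  · have e1 : (ptL p : Module.End F (CA F ℓ Γ j0)) = 0 :=
      ptL_eq_zero fun i hi => (mem_jIdx.mp hi).2 p (by omega) (by omega)
    rw [NL, e1, cA, if_neg (by omega), if_neg (by omega)]; simp
  · rw [NL, cA, cB, if_neg (by omega), if_neg (by omega), if_neg (by omega), if_neg (by omega)]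
    simp

lemma NL_shL_ne {b q : ℕ} (hq : (Pi.single q 1 : ℕ → ℕ) ∈ jIdx ℓ j0) (h1 : pb ℓ b ≠ q)
    (h2 : b ≠ q) (v : CA F ℓ Γ j0) : NL b (shL q v) = shL q (NL b v) := by
  rw [NL_apply, NL_apply, ptL_shL_ne h1 hq, ptL_shL_ne h2 hq, map_add, map_smul, map_smul]

lemma exists_T [CharZero F] {p : ℕ} (hp : p ≤ iot ℓ 6) (h : ¬ semi ℓ j0 p) :
    ∃ T : Module.End F (CA F ℓ Γ j0),
      (∀ (a : ℕ), a ≤ iot ℓ 6 → ∀ v, dg (lamW ℓ a) (T v) = T (dg (lamW ℓ a) v)) ∧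
      (∀ b, b ≤ iot ℓ 6 → b ≠ p → ∀ v, NL b (T v) = T (NL b v)) ∧
      (∀ v, NL p (T v) = T (NL p v) + v) := by
  have hc := iot_chain ℓ
  unfold semi at h
  by_cases h0 : p = 0
  · subst h0
    have hj : j0 = true := by
      cases hj : j0
      · exact absurd (Or.inl ⟨rfl, hj⟩) h
      · rfl
    have hq : (Pi.single 0 1 : ℕ → ℕ) ∈ jIdx ℓ j0 := single_mem_jIdx (fun _ => hj) (by omega)
    refine ⟨(2 : F)⁻¹ • shL 0, fun a ha v => ?_, fun b hb hne v => ?_, fun v => ?_⟩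
    · simp only [LinearMap.smul_apply, map_smul]
      congr 1
      exact dgl_shL (fun x => x) ha (Or.inl (by omega)) hq v
    · simp only [LinearMap.smul_apply, map_smul]
      rw [NL_shL_ne hq (by unfold pb; rw [if_neg hne]; omega) hne]
    · simp only [LinearMap.smul_apply, map_smul, NL_apply, pb, cA, cB, if_true, zero_smul,
        add_zero, ptL_shL_self hq]
      have h2 : (2 : F)⁻¹ * 2 = 1 := inv_mul_cancel₀ two_ne_zero
      rw [smul_add, smul_add, smul_smul (2 : F)⁻¹ 2 v, h2, one_smul,
        smul_comm (2 : F) (2 : F)⁻¹]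
  by_cases h3 : p ≤ iot ℓ 3
  · have hq : (Pi.single (p + iot ℓ 6) 1 : ℕ → ℕ) ∈ jIdx ℓ j0 := single_bar_mem (by omega) hp
    refine ⟨shL (p + iot ℓ 6), fun a ha v => ?_, fun b hb hne v => ?_, fun v => ?_⟩
    · exact dgl_shL (fun x => x) ha (Or.inr (by omega)) hq v
    · exact NL_shL_ne hq (by unfold pb; split_ifs <;> omega) (by omega) v
    · simp only [NL_apply, pb, cA, cB, h0, h3, show p ≤ iot ℓ 5 by omega, if_true, if_false,
        one_smul, ptL_shL_self hq, ptL_shL_ne (show p ≠ p + iot ℓ 6 by omega) hq, map_add,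
        neg_smul, map_neg]
      abel
  · have h5 : p ≤ iot ℓ 5 := by omega
    have hq : (Pi.single p 1 : ℕ → ℕ) ∈ jIdx ℓ j0 := single_mem_jIdx (by omega) (by omega)
    refine ⟨-(shL p : Module.End F (CA F ℓ Γ j0)), fun a ha v => ?_, fun b hb hne v => ?_, fun v => ?_⟩
    · simp only [LinearMap.neg_apply, map_neg]
      congr 1
      exact dgl_shL (fun x => x) ha (Or.inl h5) hq v
    · simp only [LinearMap.neg_apply, map_neg]
      rw [NL_shL_ne hq (by unfold pb; split_ifs <;> omega) hne]
    · simp only [NL_apply, pb, cA, cB, h0, h3, h5, if_true, if_false, LinearMap.neg_apply,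
        zero_smul, zero_add, neg_smul, one_smul, map_neg, neg_neg, ptL_shL_self hq]

lemma main_solve [CharZero F] (H : Hyp F ℓ Γ j0) (d : CA F ℓ Γ j0 →ₗ[F] CA F ℓ Γ j0)
    (hd : ∀ u v, d (brkL u v) = brkL (d u) v + brkL u (d v)) :
    ∃ u : CA F ℓ Γ j0, ∀ p, p ≤ iot ℓ 6 → DL p u = - d (Y F ℓ Γ j0 p) := by
  classical
  have hmem : ∀ {p}, p ∈ Finset.range (iot ℓ 6 + 1) ↔ p ≤ iot ℓ 6 := by
    intro p; rw [Finset.mem_range]; omega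
  obtain ⟨u, hu⟩ := solve_system (K := F) (Finset.range (iot ℓ 6 + 1))
    (fun p => (DL p : Module.End F (CA F ℓ Γ j0))) (fun p => - d (Y F ℓ Γ j0 p))
    (fun a ha b hb v => DL_comm (hmem.mp ha) (hmem.mp hb) v)
    (fun a ha b hb => by
      simp only [map_neg]
      rw [compat H (hmem.mp ha) (hmem.mp hb) d hd])
    (fun p => if semi ℓ j0 p then LinearMap.range (dg (lamW ℓ p) : Module.End F (CA F ℓ Γ j0))
      else ⊤)
    (fun a ha => by
      split_ifs with h
      · obtain ⟨x, hx⟩ := range_semi H (hmem.mp ha) (NL_semi h) d hd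
        exact ⟨-x, by rw [map_neg, hx]⟩
      · trivial)
    (fun a ha v => by
      split_ifs with h
      · exact ⟨v, by rw [DL_apply, NL_semi h]; simp⟩
      · trivial)
    (fun a ha S' hS' haS v hv hb => by
      have ha' := hmem.mp ha
      split_ifs at hv with h
      · obtain ⟨x, rfl⟩ := hv
        refine ⟨dg (fun α i => (lamW ℓ a α i)⁻¹) (dg (lamW ℓ a) x), fun b hbS => ?_, ?_⟩
        · rw [← DL_comm_dg (fun x => x⁻¹) ha', hb b hbS, map_zero]
        · rw [DL_apply, NL_semi h, dg_inv]; simp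
      · obtain ⟨T, hT1, hT2, hT3⟩ := exists_T (Γ := Γ) ha' h
        have hW : ∀ w : CA F ℓ Γ j0,
            w ∈ (⨅ b ∈ S', LinearMap.ker (DL b : Module.End F (CA F ℓ Γ j0))) ↔
            ∀ b ∈ S', DL b w = 0 := by
          intro w; simp [Submodule.mem_iInf, LinearMap.mem_ker]
        obtain ⟨u, hu, hu'⟩ := solve_nil
          (⨅ b ∈ S', LinearMap.ker (DL b : Module.End F (CA F ℓ Γ j0)))
          (dg (lamW ℓ a)) (dg (fun α i => (lamW ℓ a α i)⁻¹)) (NL a) T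
          (fun w hw => by
            rw [hW] at hw ⊢
            intro b hbS
            rw [← show dg (lamW ℓ a) (DL b w) = _ from DL_comm_dg (fun x => x) ha' w, hw b hbS,
              map_zero])
          (fun w hw => by
            rw [hW] at hw ⊢
            intro b hbS
            rw [← DL_comm_dg (fun x => x⁻¹) ha', hw b hbS, map_zero])
          (fun w hw => by
            rw [hW] at hw ⊢
            intro b hbS
            rw [← DL_comm_NL (hmem.mp (hS' hbS)), hw b hbS, map_zero])
          (fun w hw => by
            rw [hW] at hw ⊢
            intro b hbS
            have hb6 := hmem.mp (hS' hbS)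
            have hne : b ≠ a := by rintro rfl; exact haS hbS
            rw [DL_apply, hT1 b hb6, hT2 b hb6 hne, ← map_add, ← DL_apply, hw b hbS, map_zero])
          (fun w => dg_inv _ w)
          (fun w => dg_dg_comm _ _ w)
          (fun w => dgl_NL (fun x => x) ha' w)
          (fun w => hT1 a ha' w)
          (fun w => dgl_NL (fun x => x⁻¹) ha' w)
          hT3
          (fun w => nil_pt _ _ _ _ w) v ((hW v).mpr hb)
        exact ⟨u, (hW u).mp hu, hu'⟩)
  exact ⟨u, fun p hp => hu p (hmem.mpr hp)⟩

lemma covered {y : CA F ℓ Γ j0} (hy : y ∈ A1 F ℓ Γ j0 ∪ A2 F ℓ Γ j0) :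
    ∃ p, p ≤ iot ℓ 6 ∧ y = Y F ℓ Γ j0 p := by
  have hc := iot_chain ℓ
  have hY0 : Y F ℓ Γ j0 0 = X F ℓ Γ j0 0 0 := by
    simp [Y, sgm_zero_of (F := F) (ℓ := ℓ) (Or.inl rfl) (Nat.zero_le _), yi]
  have hA : ∀ p, p ≤ iot ℓ 3 → X F ℓ Γ j0 (-sgm F ℓ p) 0 = Y F ℓ Γ j0 p := by
    intro p hp; simp [Y, yi, hp]
  have hB : ∀ p, iot ℓ 3 < p → p ≤ iot ℓ 5 →
      X F ℓ Γ j0 (-sgm F ℓ p) (Pi.single (bar ℓ p) 1) = Y F ℓ Γ j0 p := by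
    intro p hp hp5
    rw [bar_of_le (by omega), Y, yi, if_neg (by omega), if_pos hp5]
  rcases hy with ((⟨p, hp, rfl⟩ | ⟨p, hp, rfl⟩) | ⟨_, rfl⟩) |
    (((⟨p, hp, rfl⟩ | ⟨p, hp, rfl⟩) | ⟨p, hp, rfl⟩) | ⟨_, rfl⟩)
  · rw [Finset.mem_coe, mem_iSet] at hp
    exact ⟨p, by omega, hA p (by omega)⟩
  · rw [Finset.mem_coe, mem_iSet] at hp
    simp only [show 5 - 1 = 4 from rfl] at hp
    exact ⟨p, by omega, hB p (by omega) (by omega)⟩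
  · exact ⟨0, by omega, hY0.symm⟩
  · rw [Finset.mem_coe, mem_iSet] at hp
    exact ⟨p, by omega, hA p (by omega)⟩
  · rw [Finset.mem_coe, mem_iSet] at hp
    simp only [show 4 - 1 = 3 from rfl] at hp
    exact ⟨p, by omega, hB p (by omega) (by omega)⟩
  · rw [Finset.mem_coe, mem_iSet] at hp
    simp only [show 6 - 1 = 5 from rfl] at hp
    refine ⟨p, by omega, ?_⟩
    dsimp only
    rw [bar_of_le (by omega), Y, yi, if_neg (by omega), if_neg (by omega),
      sgm_zero_of (by omega) (by omega), neg_zero]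
  · exact ⟨0, by omega, hY0.symm⟩

end Helpers

/-- **Claims 2 and 3.** For every derivation `d` of `𝒦` there exists `u ∈ 𝒦`
such that `(d − ad u)(y) = 0` for all `y ∈ A₁ ∪ A₂`. -/
theorem derivation_normalizable_on_A1_A2
    {F : Type*} [Field F] [CharZero F] (ℓ : ℕ → ℕ) (Γ : AddSubgroup (ℕ → F)) (j0 : Bool)
    (hℓ : 0 < iot ℓ 6)
    (hΓ1 : ∀ p ∈ jSet ℓ 1 3 ∪ iSet ℓ 4 5, (Pi.single p (1 : F) : ℕ → F) ∈ Γ)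
    (hΓ2 : ∀ α ∈ Γ, ∀ p ∈ iSet ℓ 6 6 ∪ barSet ℓ (iSet ℓ 4 6), α p = 0)
    (hΓ3 : ∀ α ∈ Γ, ∀ p, 2 * iot ℓ 6 < p → α p = 0)
    (hΓ0 : (∃ α ∈ Γ, α 0 ≠ 0) → (Pi.single 0 (1 : F) : ℕ → F) ∈ Γ)
    (hJ0 : j0 = false → ∃ α ∈ Γ, α 0 ≠ 0)
    (d : CA F ℓ Γ j0 →ₗ[F] CA F ℓ Γ j0)
    (hd : ∀ u v : CA F ℓ Γ j0,
      d (brk F ℓ Γ j0 u v) = brk F ℓ Γ j0 (d u) v + brk F ℓ Γ j0 u (d v)) :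
    ∃ u : CA F ℓ Γ j0, ∀ y ∈ A1 F ℓ Γ j0 ∪ A2 F ℓ Γ j0, d y - brk F ℓ Γ j0 u y = 0 := by
  have H : Hyp F ℓ Γ j0 :=
    { h1 := fun p h1 h2 => hΓ1 p (mem_S1.mpr (Or.inl ⟨h1, h2⟩))
      h1b := fun p h1 h2 => hΓ1 p (mem_S1.mpr (Or.inr ⟨h1, h2⟩))
      h2 := fun α hα p h1 h2 => hΓ2 α hα p (mem_S2.mpr (Or.inl ⟨h1, h2⟩))
      h2b := fun α hα p h1 h2 => hΓ2 α hα p (mem_S2.mpr (Or.inr ⟨h1, h2⟩))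
      h0 := fun hj => hΓ0 (hJ0 hj) }
  have hd' : ∀ u v : CA F ℓ Γ j0, d (brkL u v) = brkL (d u) v + brkL u (d v) := by
    intro u v
    rw [← brk_eq, ← brk_eq, ← brk_eq]
    exact hd u v
  obtain ⟨u, hu⟩ := main_solve H d hd'
  refine ⟨u, fun y hy => ?_⟩
  obtain ⟨p, hp, rfl⟩ := covered hy
  rw [brk_eq, brkL_anti, brkL_Y H hp, hu p hp]
  simp

end
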